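/- arXiv:2111.03802 — 2 statements merged into one kernel-verified Lean document; each statement's English description precedes it below -/
import Mathlib

section
/- Let M be an o-minimal structure and A ⊆ M. Let (X,τ) be a curve-compact Hausdorff definable topological space whose topology has an A-definable basis, and let C ⊆ X be a nonempty τ-closed A-definable set, C ⊆ M^m. Then C contains a point of dcl(A), i.e., there exists x ∈ C such that the singleton {x} is an A-definable subset of M^m. -/
open FirstOrder Set

/-- `M` is an o-minimal `L`-structure: a densely linearly ordered structure without endpoints,
whose order is `∅`-definable, and in which every definable (with parameters) subset of `M`
is a finite union of points and open intervals with endpoints in `M ∪ {±∞}`. -/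
def IsOMinimal (L : FirstOrder.Language) (M : Type*) [L.Structure M] [LinearOrder M] : Prop :=
  Nonempty M ∧ DenselyOrdered M ∧ NoMinOrder M ∧ NoMaxOrder M ∧
  Set.Definable (∅ : Set M) L {v : Fin 2 → M | v 0 < v 1} ∧
  ∀ s : Set M, Set.Definable₁ (Set.univ : Set M) L s →
    ∃ F : Finset (Set M), s = ⋃₀ (F : Set (Set M)) ∧
      ∀ t ∈ F, (∃ a : M, t = {a}) ∨ (∃ a b : M, t = Set.Ioo a b) ∨
        (∃ a : M, t = Set.Ioi a) ∨ (∃ a : M, t = Set.Iio a) ∨ t = Set.univ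

/-- The fiber over `u` of a set `D ⊆ M^{m+n}`, i.e. the set `φ(u, M^n)`. -/
def famFiber {M : Type*} {m n : ℕ} (D : Set (Fin m ⊕ Fin n → M)) (u : Fin m → M) :
    Set (Fin n → M) :=
  {v | Sum.elim u v ∈ D}

/-- An `A`-definable family of subsets of `M^n`: the family of fibers `φ(u, M^n)` for `u`
ranging over an `A`-definable index set `Ω`, where `φ` is `A`-definable. -/
def IsDefFamily (L : FirstOrder.Language) {M : Type*} [L.Structure M] (A : Set M) (n : ℕ)
    (S : Set (Set (Fin n → M))) : Prop :=
  ∃ (m : ℕ) (Ω : Set (Fin m → M)) (D : Set (Fin m ⊕ Fin n → M)),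
    Set.Definable A L Ω ∧ Set.Definable A L D ∧ S = famFiber D '' Ω

/-- A family of sets is downward directed: it does not contain `∅` and any two members
contain a common member. -/
def DirectedFam {α : Type*} (S : Set (Set α)) : Prop :=
  ∅ ∉ S ∧ ∀ X ∈ S, ∀ Y ∈ S, ∃ Z ∈ S, Z ⊆ X ∩ Y

/-- `S` is finer than `F`: every member of `F` contains a member of `S`. -/
def FinerThan {α : Type*} (S F : Set (Set α)) : Prop :=
  ∀ X ∈ F, ∃ Y ∈ S, Y ⊆ X

/-- A (complete) `n`-type over `M`: an ultrafilter on the Boolean algebra of definable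
subsets of `M^n`. -/
def IsTypeOn (L : FirstOrder.Language) {M : Type*} [L.Structure M] (n : ℕ)
    (p : Set (Set (Fin n → M))) : Prop :=
  (∀ X ∈ p, Set.Definable (Set.univ : Set M) L X) ∧
  ∅ ∉ p ∧
  (∀ X ∈ p, ∀ Y ∈ p, X ∩ Y ∈ p) ∧
  (∀ X ∈ p, ∀ Y : Set (Fin n → M), Set.Definable (Set.univ : Set M) L Y → X ⊆ Y → Y ∈ p) ∧
  (∀ X : Set (Fin n → M), Set.Definable (Set.univ : Set M) L X → X ∈ p ∨ Xᶜ ∈ p)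

/-- A type `p` is `A`-definable if for every `∅`-definable `D ⊆ M^{m+n}` the set of
parameters `u` with `φ(u, M^n) ∈ p` is `A`-definable. -/
def IsDefTypeOver (L : FirstOrder.Language) {M : Type*} [L.Structure M] (A : Set M) (n : ℕ)
    (p : Set (Set (Fin n → M))) : Prop :=
  ∀ (m : ℕ) (D : Set (Fin m ⊕ Fin n → M)), Set.Definable (∅ : Set M) L D →
    Set.Definable A L {u : Fin m → M | famFiber D u ∈ p}

/-- A family `F` is complete for a family `X` if each member of `X` either contains a member
of `F` or is disjoint from one. -/
def CompleteFor {α : Type*} (F X : Set (Set α)) : Prop :=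
  ∀ Y ∈ X, ∃ Z ∈ F, Z ⊆ Y ∨ Z ∩ Y = ∅

/-- A family of subsets of `M^n` is complete if it decides every definable set. -/
def IsCompleteFam (L : FirstOrder.Language) {M : Type*} [L.Structure M] (n : ℕ)
    (S : Set (Set (Fin n → M))) : Prop :=
  ∀ X : Set (Fin n → M), Set.Definable (Set.univ : Set M) L X → ∃ Z ∈ S, Z ⊆ X ∨ Z ∩ X = ∅

/-- `B` is a basis for the type `p`: a downward directed subfamily generating `p`. -/
def IsBasisOfType {α : Type*} (B p : Set (Set α)) : Prop :=
  B ⊆ p ∧ DirectedFam B ∧ ∀ Y ∈ p, ∃ Z ∈ B, Z ⊆ Y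

/-- `p` has an `A`-definable basis. -/
def HasDefBasis (L : FirstOrder.Language) {M : Type*} [L.Structure M] (A : Set M) (n : ℕ)
    (p : Set (Set (Fin n → M))) : Prop :=
  ∃ B, IsDefFamily L A n B ∧ IsBasisOfType B p

/-- `S` has a finite tame transversal: it is covered by finitely many subfamilies, each of
which extends to a definable type. -/
def HasFTT (L : FirstOrder.Language) {M : Type*} [L.Structure M] (n : ℕ)
    (S : Set (Set (Fin n → M))) : Prop :=
  ∃ (N : ℕ) (p : Fin N → Set (Set (Fin n → M))),
    (∀ i, IsTypeOn L n (p i) ∧ IsDefTypeOver L (Set.univ : Set M) n (p i)) ∧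
    ∀ X ∈ S, ∃ i, X ∈ p i

/-- The `(m,n)`-property: among any `m` members of the family, some `n` have nonempty
intersection. -/
def HasMNProperty {α : Type*} (S : Set (Set α)) (m n : ℕ) : Prop :=
  ∀ F : Finset (Set α), ↑F ⊆ S → F.card = m →
    ∃ G ⊆ F, G.card = n ∧ (⋂₀ (G : Set (Set α))).Nonempty

/-- `C` is a `τ`-closed subset of `X`. -/
def TauClosed {M : Type*} {k : ℕ} (X : Set (Fin k → M)) [TopologicalSpace ↥X]
    (C : Set (Fin k → M)) : Prop :=
  C ⊆ X ∧ IsClosed (Subtype.val ⁻¹' C : Set ↥X)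

/-- `(X,τ)` is a definable topological space with an `A`-definable basis:
`X` is `A`-definable and the topology on `X` has a basis given by an `A`-definable family. -/
def IsDefTopSpaceOver (L : FirstOrder.Language) {M : Type*} [L.Structure M] (A : Set M) {k : ℕ}
    (X : Set (Fin k → M)) [TopologicalSpace ↥X] : Prop :=
  Set.Definable A L X ∧
  ∃ B : Set (Set (Fin k → M)), IsDefFamily L A k B ∧ (∀ U ∈ B, U ⊆ X) ∧
    TopologicalSpace.IsTopologicalBasis ((fun U => (Subtype.val ⁻¹' U : Set ↥X)) '' B)

/-- `(X,τ)` is a definable topological space. -/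
def IsDefTopSpace (L : FirstOrder.Language) {M : Type*} [L.Structure M] {k : ℕ}
    (X : Set (Fin k → M)) [TopologicalSpace ↥X] : Prop :=
  IsDefTopSpaceOver L (Set.univ : Set M) X

/-- `(X,τ)` is definably compact: every definable downward directed family of nonempty
`τ`-closed subsets of `X` has nonempty intersection. -/
def DefinablyCompact (L : FirstOrder.Language) {M : Type*} [L.Structure M] {k : ℕ}
    (X : Set (Fin k → M)) [TopologicalSpace ↥X] : Prop :=
  ∀ C : Set (Set (Fin k → M)), IsDefFamily L (Set.univ : Set M) k C → DirectedFam C →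
    (∀ Y ∈ C, Y.Nonempty ∧ TauClosed X Y) → (⋂₀ C).Nonempty

/-- `x` is a limit of the type `p` in `(X,τ)`: `x` belongs to every `τ`-closed member of `p`. -/
def IsLimitOf {M : Type*} {k : ℕ} (X : Set (Fin k → M)) [TopologicalSpace ↥X]
    (p : Set (Set (Fin k → M))) (x : Fin k → M) : Prop :=
  x ∈ X ∧ ∀ C ∈ p, TauClosed X C → x ∈ C

/-- `(X,τ)` is type-compact: every definable type containing `X` has a limit in `X`. -/
def TypeCompact (L : FirstOrder.Language) {M : Type*} [L.Structure M] {k : ℕ}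
    (X : Set (Fin k → M)) [TopologicalSpace ↥X] : Prop :=
  ∀ p : Set (Set (Fin k → M)), IsTypeOn L k p → IsDefTypeOver L (Set.univ : Set M) k p →
    X ∈ p → ∃ x, IsLimitOf X p x

/-- `I` is an open interval of `M` with endpoints in `M ∪ {±∞}`. -/
def IsOpenIntervalSet {M : Type*} [LinearOrder M] (I : Set M) : Prop :=
  (∃ a b : M, I = Set.Ioo a b) ∨ (∃ a : M, I = Set.Ioi a) ∨ (∃ b : M, I = Set.Iio b) ∨
  I = Set.univ

/-- A definable curve in `X`: a definable map from a nonempty open interval into `X`. -/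
def IsDefCurve (L : FirstOrder.Language) {M : Type*} [L.Structure M] [LinearOrder M] {k : ℕ}
    (X : Set (Fin k → M)) (I : Set M) (γ : M → (Fin k → M)) : Prop :=
  IsOpenIntervalSet I ∧ I.Nonempty ∧ (∀ s ∈ I, γ s ∈ X) ∧
  Set.Definable (Set.univ : Set M) L
    {w : Fin 1 ⊕ Fin k → M | w (Sum.inl 0) ∈ I ∧ ∀ j, γ (w (Sum.inl 0)) j = w (Sum.inr j)}

/-- The curve `γ` `τ`-converges in `X` at the left endpoint of its domain `I`. -/
def CurveConvergesLeft {M : Type*} [LinearOrder M] {k : ℕ} (X : Set (Fin k → M))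
    [TopologicalSpace ↥X] (I : Set M) (γ : M → (Fin k → M)) : Prop :=
  ∃ x ∈ X, ∀ A : Set (Fin k → M), A ⊆ X → IsOpen (Subtype.val ⁻¹' A : Set ↥X) → x ∈ A →
    ∃ t ∈ I, ∀ s ∈ I, s ≤ t → γ s ∈ A

/-- The curve `γ` `τ`-converges in `X` at the right endpoint of its domain `I`. -/
def CurveConvergesRight {M : Type*} [LinearOrder M] {k : ℕ} (X : Set (Fin k → M))
    [TopologicalSpace ↥X] (I : Set M) (γ : M → (Fin k → M)) : Prop :=
  ∃ x ∈ X, ∀ A : Set (Fin k → M), A ⊆ X → IsOpen (Subtype.val ⁻¹' A : Set ↥X) → x ∈ A →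
    ∃ t ∈ I, ∀ s ∈ I, t ≤ s → γ s ∈ A

/-- `(X,τ)` is curve-compact: every definable curve in `X` converges at both endpoints. -/
def CurveCompact (L : FirstOrder.Language) {M : Type*} [L.Structure M] [LinearOrder M] {k : ℕ}
    (X : Set (Fin k → M)) [TopologicalSpace ↥X] : Prop :=
  ∀ (I : Set M) (γ : M → (Fin k → M)), IsDefCurve L X I γ →
    CurveConvergesLeft X I γ ∧ CurveConvergesRight X I γ

/-- `M` has definable choice: every definable family of nonempty sets admits a definable
choice function. -/
def HasDefinableChoice (L : FirstOrder.Language) (M : Type*) [L.Structure M] : Prop :=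
  ∀ (m k : ℕ) (Ω : Set (Fin m → M)) (D : Set (Fin m ⊕ Fin k → M)),
    Set.Definable (Set.univ : Set M) L Ω → Set.Definable (Set.univ : Set M) L D →
    (∀ u ∈ Ω, (famFiber D u).Nonempty) →
    ∃ s : (Fin m → M) → (Fin k → M),
      (∀ u ∈ Ω, Sum.elim u (s u) ∈ D) ∧
      Set.Definable (Set.univ : Set M) L
        {w : Fin m ⊕ Fin k → M | (w ∘ Sum.inl) ∈ Ω ∧ s (w ∘ Sum.inl) = w ∘ Sum.inr}


section Helpers

variable {L : FirstOrder.Language} {M : Type*} [L.Structure M] {A : Set M}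

theorem def_ex {α β : Type*} [Finite β] {p : (α → M) → (β → M) → Prop}
    (h : A.Definable L {z : α ⊕ β → M | p (fun a => z (Sum.inl a)) (fun b => z (Sum.inr b))}) :
    A.Definable L {v : α → M | ∃ u : β → M, p v u} := by
  have := h.exists_of_finite
  simpa using this

theorem def_all {α β : Type*} [Finite β] {p : (α → M) → (β → M) → Prop}
    (h : A.Definable L {z : α ⊕ β → M | p (fun a => z (Sum.inl a)) (fun b => z (Sum.inr b))}) :
    A.Definable L {v : α → M | ∀ u : β → M, p v u} := by
  have := h.forall_of_finite
  simpa using this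

theorem def_ex1 {α : Type*} {p : (α → M) → M → Prop}
    (h : A.Definable L {z : α ⊕ Fin 1 → M | p (fun a => z (Sum.inl a)) (z (Sum.inr 0))}) :
    A.Definable L {v : α → M | ∃ t : M, p v t} := by
  have := h.exists_of_finite
  convert this using 2
  ext v
  exact ⟨fun ⟨t, ht⟩ => ⟨fun _ => t, ht⟩, fun ⟨u, hu⟩ => ⟨u 0, hu⟩⟩

theorem def_all1 {α : Type*} {p : (α → M) → M → Prop}
    (h : A.Definable L {z : α ⊕ Fin 1 → M | p (fun a => z (Sum.inl a)) (z (Sum.inr 0))}) :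
    A.Definable L {v : α → M | ∀ t : M, p v t} := by
  have := h.forall_of_finite
  convert this using 2
  ext v
  exact ⟨fun h u => h (u 0), fun h t => h (fun _ => t)⟩

theorem def_and {α : Type*} {p q : (α → M) → Prop}
    (hp : A.Definable L {v | p v}) (hq : A.Definable L {v | q v}) :
    A.Definable L {v | p v ∧ q v} := hp.inter hq

theorem def_not {α : Type*} {p : (α → M) → Prop}
    (hp : A.Definable L {v | p v}) : A.Definable L {v | ¬ p v} := hp.compl

theorem def_imp {α : Type*} {p q : (α → M) → Prop}
    (hp : A.Definable L {v | p v}) (hq : A.Definable L {v | q v}) :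
    A.Definable L {v | p v → q v} := by
  have := hp.compl.union hq
  convert this using 1
  ext v
  exact imp_iff_not_or

theorem def_mem {α β : Type*} [Finite β] {S : Set (β → M)} (hS : A.Definable L S)
    {F : (α → M) → (β → M)} (hF : A.DefinableMap L F) :
    A.Definable L {v | F v ∈ S} := hS.preimage_map hF

theorem def_elim {α β γ : Type*} {f : (α → M) → β → M} {g : (α → M) → γ → M}
    (hf : A.DefinableMap L f) (hg : A.DefinableMap L g) :
    A.DefinableMap L (fun v => Sum.elim (f v) (g v)) := by
  rintro (i | i)
  · exact hf i
  · exact hg i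

theorem def_cons {α : Type*} {n : ℕ} {t : (α → M) → M} {f : (α → M) → Fin n → M}
    (ht : A.DefinableFun L t) (hf : A.DefinableMap L f) :
    A.DefinableMap L (fun v => (Fin.cons (t v) (f v) : Fin (n + 1) → M)) := by
  intro i
  refine Fin.cases ?_ (fun j => ?_) i
  · simpa using ht
  · simpa using hf j

theorem def_proj {α β : Type*} (f : β → α) :
    A.DefinableMap L (fun (v : α → M) b => v (f b)) := fun _ => DefinableFun.proj L

theorem def_lt [LinearOrder M] (h : (∅ : Set M).Definable L {v : Fin 2 → M | v 0 < v 1})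
    {α : Type*} {f g : (α → M) → M} (hf : A.DefinableFun L f) (hg : A.DefinableFun L g) :
    A.Definable L {v | f v < g v} := by
  have hF : A.DefinableMap L (fun v => ![f v, g v]) := by
    intro i
    fin_cases i
    · exact hf
    · exact hg
  exact (h.mono (empty_subset A)).preimage_map hF

theorem def_interval [LinearOrder M]
    (h : (∅ : Set M).Definable L {v : Fin 2 → M | v 0 < v 1})
    {I : Set M} (hI : IsOpenIntervalSet I) {α : Type*} (i : α) :
    (univ : Set M).Definable L {v : α → M | v i ∈ I} := by
  have hc : ∀ a : M, (univ : Set M).DefinableFun L (fun _ : α → M => a) :=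
    fun a => L.definableFun_const α (mem_univ a)
  have hp : (univ : Set M).DefinableFun L (fun v : α → M => v i) := DefinableFun.proj L
  rcases hI with ⟨a, b, rfl⟩ | ⟨a, rfl⟩ | ⟨a, rfl⟩ | rfl
  · exact def_and (def_lt h (hc a) hp) (def_lt h hp (hc b))
  · exact def_lt h (hc a) hp
  · exact def_lt h hp (hc a)
  · exact definable_univ

/-- A nonempty definable subset of the line has a maximum or ends with an open interval. -/
theorem omin_top [LinearOrder M] (hM : IsOMinimal L M) {s : Set M}
    (hs : (univ : Set M).Definable₁ L s) (hne : s.Nonempty) :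
    (∃ a ∈ s, ∀ x ∈ s, x ≤ a) ∨
    ∃ I : Set M, IsOpenIntervalSet I ∧ I.Nonempty ∧ I ⊆ s ∧
      ∀ x ∈ s, ∀ y ∈ I, y ≤ x → x ∈ I := by
  obtain ⟨F, hF, hF'⟩ := hM.2.2.2.2.2 s hs
  have hfin : {t | t ∈ F ∧ t.Nonempty}.Finite := F.finite_toSet.subset (fun t ht => ht.1)
  have hne' : {t | t ∈ F ∧ t.Nonempty}.Nonempty := by
    obtain ⟨x, hx⟩ := hne
    rw [hF] at hx
    obtain ⟨t, ht, hxt⟩ := hx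
    exact ⟨t, ht, x, hxt⟩
  obtain ⟨t, ⟨htF, htne⟩, hmax⟩ := hfin.exists_maximalFor
    (fun t : Set M => {x | ∃ y ∈ t, x ≤ y}) _ hne'
  have hts : t ⊆ s := by
    rw [hF]
    exact subset_sUnion_of_mem htF
  have hcof : ∀ x ∈ s, ∃ y ∈ t, x ≤ y := by
    intro x hx
    rw [hF] at hx
    obtain ⟨r, hr, hxr⟩ := hx
    by_contra! hcon
    have h1 : {x | ∃ y ∈ t, x ≤ y} ⊆ {x | ∃ y ∈ r, x ≤ y} := by
      rintro z ⟨y, hy, hzy⟩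
      exact ⟨x, hxr, hzy.trans (hcon y hy).le⟩
    obtain ⟨y, hy, hxy⟩ := hmax ⟨hr, x, hxr⟩ h1 ⟨x, hxr, le_refl x⟩
    exact absurd hxy (not_le.2 (hcon y hy))
  have key : t.OrdConnected → ∀ x ∈ s, ∀ y ∈ t, y ≤ x → x ∈ t := by
    intro hoc x hx y hy hyx
    obtain ⟨z, hz, hxz⟩ := hcof x hx
    exact hoc.out hy hz ⟨hyx, hxz⟩
  rcases hF' t htF with ⟨a, rfl⟩ | hI
  · left
    refine ⟨a, hts rfl, fun x hx => ?_⟩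
    obtain ⟨y, rfl, hy⟩ := hcof x hx
    exact hy
  · right
    refine ⟨t, hI, htne, hts, key ?_⟩
    rcases hI with ⟨a, b, rfl⟩ | ⟨a, rfl⟩ | ⟨a, rfl⟩ | rfl
    · exact ordConnected_Ioo
    · exact ordConnected_Ioi
    · exact ordConnected_Iio
    · exact ordConnected_univ

end Helpers

theorem choice_aux {L : FirstOrder.Language} {M : Type*} [L.Structure M] [LinearOrder M]
    (hM : IsOMinimal L M) (A : Set M) (k : ℕ) (X : Set (Fin k → M)) [TopologicalSpace ↥X]
    (hX : IsDefTopSpaceOver L A X) (hcc : CurveCompact L X) (hT2 : T2Space ↥X)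
    (C : Set (Fin k → M)) (hCclosed : TauClosed X C) (n : ℕ) :
    ∀ G : Set (Fin n ⊕ Fin k → M), A.Definable L G → G.Nonempty →
      (∀ u w w', Sum.elim u w ∈ G → Sum.elim u w' ∈ G → w = w') →
      (∀ u w, Sum.elim u w ∈ G → w ∈ C) →
      ∃ x ∈ C, Set.Definable A L ({x} : Set (Fin k → M)) := by
  induction n with
  | zero =>
    intro G hG hne hfun hC
    obtain ⟨z, hz⟩ := hne
    have hz' : Sum.elim (fun i => z (Sum.inl i)) (fun i => z (Sum.inr i)) ∈ G := by
      convert hz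
      ext (i | i) <;> rfl
    refine ⟨_, hC _ _ hz', ?_⟩
    have := def_mem (α := Fin k) hG
      (def_elim (f := fun v i => i.elim0) (fun i => i.elim0) (def_proj id))
    convert this using 1
    ext v
    have he : (fun i : Fin 0 => (i.elim0 : M)) = fun i => z (Sum.inl i) := funext fun i => i.elim0
    simp only [mem_singleton_iff, mem_ofPred_eq]
    rw [he]
    constructor
    · rintro rfl
      exact hz'
    · intro hv
      exact hfun _ _ _ hv hz'
  | succ n ih =>
    intro G hG hne hfun hC
    obtain ⟨hXd, B, ⟨m, Ω, D, hΩ, hD, rfl⟩, hBX, hB⟩ := hX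
    have hlt := hM.2.2.2.2.1
    let R : (Fin n → M) → M → (Fin k → M) → Prop :=
      fun u t w => Sum.elim (Fin.cons t u : Fin (n + 1) → M) w ∈ G
    let Lim : (Fin n → M) → (Fin k → M) → Prop := fun u v =>
      (∃ t w, R u t w) ∧ v ∈ X ∧ ∀ ω : Fin m → M, ω ∈ Ω → Sum.elim ω v ∈ D →
        ∃ t w, R u t w ∧ ∀ s w', ¬ (s < t) → R u s w' → Sum.elim ω w' ∈ D
    have hRfun : ∀ {u t w w'}, R u t w → R u t w' → w = w' := fun h h' => hfun _ _ _ h h'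
    have hRC : ∀ {u t w}, R u t w → w ∈ C := fun h => hC _ _ h
    -- from basic neighbourhoods to arbitrary ones
    have hnhds : ∀ {u v}, Lim u v → ∀ hv : v ∈ X, ∀ O : Set ↥X, IsOpen O → (⟨v, hv⟩ : ↥X) ∈ O →
        ∃ t w, R u t w ∧ ∀ s w', ¬ (s < t) → R u s w' → ∃ h : w' ∈ X, (⟨w', h⟩ : ↥X) ∈ O := by
      intro u v hl hv O hO hvO
      obtain ⟨_, ⟨_, ⟨ω, hω, rfl⟩, rfl⟩, hvU, hUO⟩ := hB.exists_subset_of_mem_open hvO hO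
      obtain ⟨t, w, hR, hall⟩ := hl.2.2 ω hω hvU
      refine ⟨t, w, hR, fun s w' hs hw' => ?_⟩
      exact ⟨hCclosed.1 (hRC hw'), hUO (hall s w' hs hw')⟩
    refine ih {z | Lim (fun i => z (Sum.inl i)) (fun i => z (Sum.inr i))} ?_ ?_ ?_ ?_
    · -- definability
      have hR : ∀ {α : Type} {u : (α → M) → Fin n → M} {t : (α → M) → M}
          {w : (α → M) → Fin k → M}, A.DefinableMap L u → A.DefinableFun L t →
          A.DefinableMap L w → A.Definable L {z | R (u z) (t z) (w z)} :=
        fun hu ht hw => def_mem hG (def_elim (def_cons ht hu) hw)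
      refine def_and ?_ (def_and ?_ ?_)
      · refine def_ex1 (def_ex ?_)
        exact hR (def_proj _) (DefinableFun.proj L) (def_proj _)
      · exact def_mem hXd (def_proj _)
      · refine def_all (def_imp ?_ (def_imp ?_ (def_ex1 (def_ex (def_and ?_ (def_all1
          (def_all (def_imp ?_ (def_imp ?_ ?_)))))))))
        · exact def_mem hΩ (def_proj _)
        · exact def_mem hD (def_elim (def_proj _) (def_proj _))
        · exact hR (def_proj _) (DefinableFun.proj L) (def_proj _)
        · exact def_not (def_lt hlt (DefinableFun.proj L) (DefinableFun.proj L))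
        · exact hR (def_proj _) (DefinableFun.proj L) (def_proj _)
        · exact def_mem hD (def_elim (def_proj _) (def_proj _))
    · -- existence of limits
      obtain ⟨z, hz⟩ := hne
      let u : Fin n → M := fun i => z (Sum.inl i.succ)
      have hz' : R u (z (Sum.inl 0)) (fun i => z (Sum.inr i)) := by
        show Sum.elim _ _ ∈ G
        convert hz
        ext (i | i)
        · refine Fin.cases ?_ (fun j => ?_) i <;> rfl
        · rfl
      suffices h : ∃ v, Lim u v by
        obtain ⟨v, hv⟩ := h
        exact ⟨Sum.elim u v, hv⟩
      have hex : ∃ t w, R u t w := ⟨_, _, hz'⟩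
      have hGu : (univ : Set M).Definable L G := hG.mono (subset_univ A)
      have hconst : ∀ {α : Type}, (univ : Set M).DefinableMap L (fun _ : α → M => u) :=
        fun {α} i => L.definableFun_const α (mem_univ _)
      have hS : (univ : Set M).Definable₁ L {t | ∃ w, R u t w} := by
        show Set.Definable _ L {x : Fin 1 → M | ∃ w, R u (x 0) w}
        refine def_ex ?_
        exact def_mem hGu (def_elim (def_cons (DefinableFun.proj L) hconst) (def_proj _))
      rcases omin_top hM hS hex with ⟨a, ⟨w, hw⟩, ha⟩ | ⟨I, hI, hIne, hIS, hIup⟩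
      · refine ⟨w, hex, hCclosed.1 (hRC hw), fun ω hω hwD => ⟨a, w, hw, fun s w' hs hw' => ?_⟩⟩
        have : s = a := le_antisymm (ha s ⟨w', hw'⟩) (not_lt.1 hs)
        subst this
        rw [hRfun hw' hw]
        exact hwD
      · classical
        let γ : M → Fin k → M := fun t => if h : ∃ w, R u t w then h.choose else fun _ => t
        have hγ : ∀ t ∈ I, R u t (γ t) := by
          intro t ht
          have h : ∃ w, R u t w := hIS ht
          simp only [γ, dif_pos h]
          exact h.choose_spec
        have hcurve : IsDefCurve L X I γ := by
          refine ⟨hI, hIne, fun s hs => hCclosed.1 (hRC (hγ s hs)), ?_⟩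
          have : (univ : Set M).Definable L {w : Fin 1 ⊕ Fin k → M | w (Sum.inl 0) ∈ I ∧
              R u (w (Sum.inl 0)) (fun j => w (Sum.inr j))} := by
            refine def_and (def_interval hlt hI _) ?_
            exact def_mem hGu (def_elim (def_cons (DefinableFun.proj L) hconst) (def_proj _))
          convert this using 1
          ext w
          refine and_congr_right fun hwI => ?_
          constructor
          · intro h
            have : γ (w (Sum.inl 0)) = fun j => w (Sum.inr j) := funext h
            rw [← this]
            exact hγ _ hwI
          · intro h j
            rw [hRfun (hγ _ hwI) h]
        obtain ⟨x, hxX, hx⟩ := (hcc I γ hcurve).2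
        refine ⟨x, hex, hxX, fun ω hω hxD => ?_⟩
        have hmem : famFiber D ω ∈ famFiber D '' Ω := ⟨ω, hω, rfl⟩
        obtain ⟨t, htI, ht⟩ := hx (famFiber D ω) (hBX _ hmem) (hB.isOpen ⟨_, hmem, rfl⟩) hxD
        refine ⟨t, γ t, hγ t htI, fun s w' hs hw' => ?_⟩
        have hsI : s ∈ I := hIup s ⟨w', hw'⟩ t htI (not_lt.1 hs)
        have := ht s hsI (not_lt.1 hs)
        rw [hRfun (hγ s hsI) hw'] at this
        exact this
    · -- uniqueness
      intro u v v' hv hv'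
      have hv : Lim u v := hv
      have hv' : Lim u v' := hv'
      by_contra hne'
      have hne2 : (⟨v, hv.2.1⟩ : ↥X) ≠ ⟨v', hv'.2.1⟩ := fun h => hne' (congrArg Subtype.val h)
      obtain ⟨O, O', hO, hO', hvO, hvO', hdisj⟩ := t2_separation hne2
      obtain ⟨t, w, hR, hall⟩ := hnhds hv hv.2.1 O hO hvO
      obtain ⟨t', w', hR', hall'⟩ := hnhds hv' hv'.2.1 O' hO' hvO'
      rcases le_total t t' with h | h
      · obtain ⟨h1, h2⟩ := hall t' w' (not_lt.2 h) hR'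
        obtain ⟨h3, h4⟩ := hall' t' w' (lt_irrefl _) hR'
        exact Set.disjoint_left.1 hdisj h2 h4
      · obtain ⟨h1, h2⟩ := hall t w (lt_irrefl _) hR
        obtain ⟨h3, h4⟩ := hall' t w (not_lt.2 h) hR
        exact Set.disjoint_left.1 hdisj h2 h4
    · -- limits lie in C
      intro u v hv
      have hv : Lim u v := hv
      by_contra hvC
      obtain ⟨t, w, hR, hall⟩ := hnhds hv hv.2.1 _ hCclosed.2.isOpen_compl hvC
      obtain ⟨h1, h2⟩ := hall t w (lt_irrefl _) hR
      exact h2 (hRC hR)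

/-- definable choice in curve-compact Hausdorff spaces: a nonempty `τ`-closed
`A`-definable subset of a curve-compact Hausdorff definable topological space with an
`A`-definable basis contains a point of `dcl(A)`. -/
theorem statement17 (L : FirstOrder.Language) (M : Type*) [L.Structure M] [LinearOrder M]
    (hM : IsOMinimal L M) (A : Set M) (k : ℕ) (X : Set (Fin k → M)) [TopologicalSpace ↥X]
    (hX : IsDefTopSpaceOver L A X) (hcc : CurveCompact L X) (hT2 : T2Space ↥X)
    (C : Set (Fin k → M)) (hCne : C.Nonempty) (hCclosed : TauClosed X C)
    (hCdef : Set.Definable A L C) :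
    ∃ x ∈ C, Set.Definable A L ({x} : Set (Fin k → M)) := by
  refine choice_aux hM A k X hX hcc hT2 C hCclosed k
    ((fun g : Fin k → M => g ∘ Sum.elim id id) '' C) (hCdef.image_comp _) (hCne.image _) ?_ ?_
  · rintro u w w' ⟨g, -, hg⟩ ⟨g', -, hg'⟩
    funext i
    have h1 := congrFun hg (Sum.inl i)
    have h2 := congrFun hg (Sum.inr i)
    have h3 := congrFun hg' (Sum.inl i)
    have h4 := congrFun hg' (Sum.inr i)
    simp at h1 h2 h3 h4
    rw [← h2, ← h4, h1, h3]
  · rintro u w ⟨g, hg, hgw⟩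
    have : w = g := by
      funext i
      have h2 := congrFun hgw (Sum.inr i)
      simpa using h2.symm
    rw [this]
    exact hg
end

section
/- Let M be an o-minimal structure whose universe is ℝ and in which the usual linear order of the real numbers is the distinguished definable order (an o-minimal expansion of (ℝ,<)). Then a definable topological space (X,τ) in M is definably compact if and only if the topological space (X,τ) is compact. -/
open FirstOrder Set

set_option autoImplicit false

namespace OM

/-- Types with real coordinates. -/
class DSpace (X : Type) where
  ι : Type
  fin : Finite ι
  e : X ≃ (ι → ℝ)

instance (X : Type) [DSpace X] : Finite (DSpace.ι X) := DSpace.fin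

instance instPi (α : Type) [Finite α] : DSpace (α → ℝ) := ⟨α, inferInstance, Equiv.refl _⟩
instance instR : DSpace ℝ := ⟨Unit, inferInstance, (Equiv.funUnique Unit ℝ).symm⟩
instance instProd (X Y : Type) [DSpace X] [DSpace Y] : DSpace (X × Y) :=
  ⟨DSpace.ι X ⊕ DSpace.ι Y, inferInstance,
    (Equiv.prodCongr DSpace.e DSpace.e).trans (Equiv.sumArrowEquivProdArrow _ _ _).symm⟩

section infra
variable (L : FirstOrder.Language) [L.Structure ℝ]
variable {X Y Z : Type} [DSpace X] [DSpace Y] [DSpace Z]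

/-- Definable predicates (with parameters). -/
def DefP (P : X → Prop) : Prop :=
  Set.Definable (Set.univ : Set ℝ) L {v : DSpace.ι X → ℝ | P (DSpace.e.symm v)}

/-- Definable maps (coordinatewise). -/
@[fun_prop]
def DM (f : X → Y) : Prop :=
  ∀ b, Set.DefinableFun L (Set.univ : Set ℝ)
    (fun v : DSpace.ι X → ℝ => DSpace.e (f (DSpace.e.symm v)) b)

variable {L}

theorem DefP.comp {P : Y → Prop} (hP : DefP L P) {f : X → Y} (hf : DM L f) :
    DefP L (fun x => P (f x)) := by
  have := Set.Definable.preimage_map (F := fun v : DSpace.ι X → ℝ =>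
    DSpace.e (f (DSpace.e.symm v))) hf hP
  simpa [DefP] using this

@[fun_prop]
theorem DM.comp {g : Y → Z} (hg : DM L g) {f : X → Y} (hf : DM L f) :
    DM L (fun x => g (f x)) := by
  intro b
  have := Set.DefinableFun.comp (g := fun v : DSpace.ι X → ℝ =>
    DSpace.e (f (DSpace.e.symm v))) hf (hg b)
  simpa using this

@[fun_prop]
theorem DM.id : DM L (fun x : X => x) := by
  intro b
  simp only [Equiv.apply_symm_apply]
  fun_prop

theorem DM.fst : DM L (fun x : X × Y => x.1) := by
  intro b
  have : (fun v : DSpace.ι (X × Y) → ℝ => DSpace.e (DSpace.e.symm v).1 b) =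
      fun v => v (Sum.inl b) := by
    funext v
    simp [DSpace.e]
    rfl
  rw [this]
  exact Set.DefinableFun.proj L

theorem DM.snd : DM L (fun x : X × Y => x.2) := by
  intro b
  have : (fun v : DSpace.ι (X × Y) → ℝ => DSpace.e (DSpace.e.symm v).2 b) =
      fun v => v (Sum.inr b) := by
    funext v
    simp [DSpace.e]
    rfl
  rw [this]
  exact Set.DefinableFun.proj L

theorem DM.pair {f : X → Y} {g : X → Z} (hf : DM L f) (hg : DM L g) :
    DM L (fun x => (f x, g x)) := by
  rintro (b | b)
  · exact hf b
  · exact hg b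

@[fun_prop]
theorem DM.const (c : Y) : DM L (fun _ : X => c) := by
  intro b
  exact FirstOrder.Language.definableFun_const L _ (Set.mem_univ _)

@[fun_prop]
theorem DM.eval {α : Type} [Finite α] (a : α) : DM L (fun v : α → ℝ => v a) := by
  intro b
  exact Set.DefinableFun.proj L

@[fun_prop]
theorem DM.pi {α : Type} [Finite α] {f : X → α → ℝ} (h : ∀ a, DM L (fun x => f x a)) :
    DM L f := fun b => h b ()

theorem DM.app {α : Type} [Finite α] {f : X → α → ℝ} (h : DM L f) (a : α) :
    DM L (fun x => f x a) := (DM.eval a).comp h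

theorem DefP.and {P Q : X → Prop} (hP : DefP L P) (hQ : DefP L Q) :
    DefP L (fun x => P x ∧ Q x) := Set.Definable.inter hP hQ
theorem DefP.or {P Q : X → Prop} (hP : DefP L P) (hQ : DefP L Q) :
    DefP L (fun x => P x ∨ Q x) := Set.Definable.union hP hQ
theorem DefP.not {P : X → Prop} (hP : DefP L P) : DefP L (fun x => ¬ P x) :=
  Set.Definable.compl hP
theorem DefP.cgr {P Q : X → Prop} (hP : DefP L P) (h : ∀ x, P x ↔ Q x) : DefP L Q := by
  have : P = Q := funext fun x => propext (h x)
  rwa [← this]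
theorem DefP.imp {P Q : X → Prop} (hP : DefP L P) (hQ : DefP L Q) :
    DefP L (fun x => P x → Q x) := (hP.not.or hQ).cgr fun x => by tauto
theorem DefP.iff {P Q : X → Prop} (hP : DefP L P) (hQ : DefP L Q) :
    DefP L (fun x => P x ↔ Q x) := ((hP.imp hQ).and (hQ.imp hP)).cgr fun x => by tauto
theorem DefP.cst (p : Prop) : DefP L (fun _ : X => p) := by
  by_cases h : p
  · have : (fun _ : X => p) = fun _ => True := by simp [h]
    rw [this]; exact Set.definable_univ
  · have : (fun _ : X => p) = fun _ => False := by simp [h]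
    rw [this]; exact Set.definable_empty

theorem DefP.ex' {P : X × Y → Prop} (hP : DefP L P) : DefP L (fun x => ∃ y, P (x, y)) := by
  have := Set.Definable.exists_of_finite hP
  unfold DefP
  convert this using 1
  ext v
  simp only [Set.mem_ofPred_eq]
  constructor
  · rintro ⟨y, hy⟩
    refine ⟨DSpace.e y, ?_⟩
    have : DSpace.e.symm (Sum.elim v (DSpace.e y)) = ((DSpace.e.symm v, y) : X × Y) := by
      rw [Equiv.symm_apply_eq]
      simp [DSpace.e]
      rfl
    change P (DSpace.e.symm (Sum.elim v (DSpace.e y)))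
    rw [this]; exact hy
  · rintro ⟨w, hw⟩
    exact ⟨DSpace.e.symm w, hw⟩

theorem DefP.ex {P : X → Y → Prop} (hP : DefP L (fun z : X × Y => P z.1 z.2)) :
    DefP L (fun x => ∃ y, P x y) := hP.ex'

theorem DefP.all {P : X → Y → Prop} (hP : DefP L (fun z : X × Y => P z.1 z.2)) :
    DefP L (fun x => ∀ y, P x y) := ((DefP.ex (P := fun x y => ¬ P x y) hP.not).not).cgr fun x => by simp

theorem DefP.allF {α : Type} [Finite α] {P : X → α → Prop} (h : ∀ a, DefP L (fun x => P x a)) :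
    DefP L (fun x => ∀ a, P x a) := by
  have := Set.definable_iInter_of_finite h
  unfold DefP
  convert this using 1
  ext v; simp

theorem DefP.eq {f g : X → ℝ} (hf : DM L f) (hg : DM L g) : DefP L (fun x => f x = g x) := by
  have : DefP L (fun v : Fin 2 → ℝ => v 0 = v 1) :=
    ⟨(FirstOrder.Language.Term.equal (FirstOrder.Language.Term.var (0 : Fin 2))
      (FirstOrder.Language.Term.var (1 : Fin 2))), by ext v; simp [DSpace.e]; rfl⟩
  have h2 : DM L (fun x => ![f x, g x]) := DM.pi fun a => by
    fin_cases a
    · exact hf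
    · exact hg
  exact this.comp h2

theorem DefP.lt (hR : IsOMinimal L ℝ) {f g : X → ℝ} (hf : DM L f) (hg : DM L g) :
    DefP L (fun x => f x < g x) := by
  have : DefP L (fun v : Fin 2 → ℝ => v 0 < v 1) :=
    hR.2.2.2.2.1.mono (Set.empty_subset _)
  have h2 : DM L (fun x => ![f x, g x]) := DM.pi fun a => by
    fin_cases a
    · exact hf
    · exact hg
  exact this.comp h2

theorem DefP.le (hR : IsOMinimal L ℝ) {f g : X → ℝ} (hf : DM L f) (hg : DM L g) :
    DefP L (fun x => f x ≤ g x) := (DefP.lt hR hg hf).not.cgr fun _ => not_lt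

theorem DefP.eqPi {α : Type} [Finite α] {f g : X → α → ℝ} (hf : DM L f) (hg : DM L g) :
    DefP L (fun x => f x = g x) :=
  (DefP.allF fun a => DefP.eq (hf.app a) (hg.app a)).cgr fun _ => funext_iff.symm

@[fun_prop]
theorem DM.snoc {n : ℕ} {f : X → Fin n → ℝ} {g : X → ℝ} (hf : DM L f) (hg : DM L g) :
    DM L (fun x => (Fin.snoc (f x) (g x) : Fin (n+1) → ℝ)) := DM.pi fun a => by
  refine Fin.lastCases ?_ (fun i => ?_) a
  · simpa using hg
  · simpa using hf.app i

@[fun_prop]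
theorem DM.init {n : ℕ} {f : X → Fin (n+1) → ℝ} (hf : DM L f) :
    DM L (fun x => (Fin.init (f x) : Fin n → ℝ)) := DM.pi fun a => hf.app a.castSucc

@[fun_prop]
theorem DM.elim {α β : Type} [Finite α] [Finite β] {f : X → α → ℝ} {g : X → β → ℝ}
    (hf : DM L f) (hg : DM L g) : DM L (fun x => (Sum.elim (f x) (g x) : α ⊕ β → ℝ)) :=
  DM.pi fun a => by
    rcases a with a | a
    · exact hf.app a
    · exact hg.app a

/-- Definable open quantifier on `ℝ^n`. -/
theorem DefP.ev (hR : IsOMinimal L ℝ) {n : ℕ} {P : X → (Fin n → ℝ) → Prop} {f : X → Fin n → ℝ}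
    (hP : DefP L (fun z : X × (Fin n → ℝ) => P z.1 z.2)) (hf : DM L f) :
    DefP L (fun x => ∀ᶠ y in nhds (f x), P x y) := by
  have key : DefP L (fun x => ∃ l u : Fin n → ℝ, (∀ i, l i < f x i ∧ f x i < u i) ∧
      ∀ y : Fin n → ℝ, (∀ i, l i < y i ∧ y i < u i) → P x y) := by
    refine DefP.ex (DefP.ex (DefP.and (DefP.allF fun i => DefP.and ?_ ?_)
      (DefP.all (DefP.imp (DefP.allF fun i => DefP.and ?_ ?_) ?_))))
    · exact DefP.lt hR ((DM.snd.comp DM.fst).app i) ((hf.comp (DM.fst.comp DM.fst)).app i)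
    · exact DefP.lt hR ((hf.comp (DM.fst.comp DM.fst)).app i) (DM.snd.app i)
    · exact DefP.lt hR ((DM.snd.comp (DM.fst.comp DM.fst)).app i) (DM.snd.app i)
    · exact DefP.lt hR (DM.snd.app i) ((DM.snd.comp DM.fst).app i)
    · exact hP.comp ((DM.fst.comp (DM.fst.comp DM.fst)).pair DM.snd)
  refine key.cgr fun x => ?_
  constructor
  · rintro ⟨l, u, h1, h2⟩
    have : Set.pi Set.univ (fun i => Set.Ioo (l i) (u i)) ∈ nhds (f x) :=
      set_pi_mem_nhds Set.finite_univ fun i _ => Ioo_mem_nhds (h1 i).1 (h1 i).2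
    filter_upwards [this] with y hy
    exact h2 y fun i => hy i trivial
  · intro h
    obtain ⟨ε, hε, h⟩ := Metric.eventually_nhds_iff.1 h
    refine ⟨fun i => f x i - ε/2, fun i => f x i + ε/2, fun i => ⟨by linarith, by linarith⟩,
      fun y hy => h ?_⟩
    refine lt_of_le_of_lt ((dist_pi_le_iff (by linarith : (0:ℝ) ≤ ε/2)).2 fun i => ?_)
      (by linarith : ε/2 < ε)
    rw [Real.dist_eq, abs_le]
    constructor <;> linarith [(hy i).1, (hy i).2]

theorem defP_iff {α : Type} [Finite α] (S : Set (α → ℝ)) :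
    DefP L (fun v => v ∈ S) ↔ Set.Definable (Set.univ : Set ℝ) L S := Iff.rfl


@[fun_prop]
theorem DM.fst' {f : X → Y × Z} (hf : DM L f) : DM L (fun x => (f x).1) := DM.fst.comp hf
@[fun_prop]
theorem DM.snd' {f : X → Y × Z} (hf : DM L f) : DM L (fun x => (f x).2) := DM.snd.comp hf
attribute [fun_prop] DM.pair

theorem DefP.comp2 {P : Y → Z → Prop} (h : DefP L (fun z : Y × Z => P z.1 z.2)) {f : X → Y}
    {g : X → Z} (hf : DM L f) (hg : DM L g) : DefP L (fun x => P (f x) (g x)) :=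
  h.comp (hf.pair hg)

theorem DefP.comp3 {W : Type} [DSpace W] {P : Y → Z → W → Prop}
    (h : DefP L (fun z : Y × Z × W => P z.1 z.2.1 z.2.2)) {f : X → Y}
    {g : X → Z} {k : X → W} (hf : DM L f) (hg : DM L g) (hk : DM L k) :
    DefP L (fun x => P (f x) (g x) (k x)) :=
  h.comp (hf.pair (hg.pair hk))

end infra

end OM

namespace OM

section baire
variable {L : FirstOrder.Language} [L.Structure ℝ]

theorem finite_frontier (hR : IsOMinimal L ℝ) {T : ℝ → Prop} (hT : DefP L T) :
    (frontier {y | T y}).Finite := by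
  have h1 : Set.Definable₁ (Set.univ : Set ℝ) L {y | T y} := by
    have : DefP L (fun v : Fin 1 → ℝ => T (v 0)) := hT.comp (by fun_prop)
    exact this
  obtain ⟨F, hF, ht⟩ := hR.2.2.2.2.2 _ h1
  rw [hF]
  clear hF
  induction F using Finset.induction_on with
  | empty => simp
  | insert a s ha ih =>
    have h2 := ih (fun t h => ht t (Finset.mem_insert_of_mem h))
    rw [Finset.coe_insert, Set.sUnion_insert]
    have h3 : (frontier a).Finite := by
      rcases ht a (Finset.mem_insert_self _ _) with ⟨c, rfl⟩ | ⟨c, d, rfl⟩ | ⟨c, rfl⟩ | ⟨c, rfl⟩ | rfl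
      · exact (Set.finite_singleton c).subset (isClosed_singleton.frontier_subset)
      · by_cases h : c < d
        · rw [frontier_Ioo h]; simp
        · rw [Set.Ioo_eq_empty h]; simp
      · rw [frontier_Ioi]; simp
      · rw [frontier_Iio]; simp
      · simp
    refine (h3.union h2).subset ((frontier_union_subset _ _).trans ?_)
    exact Set.union_subset_union Set.inter_subset_left Set.inter_subset_right

theorem exists_ratIoo (hR : IsOMinimal L ℝ) {T : ℝ → Prop} (hT : DefP L T) {a b : ℝ} (hab : a < b) :
    ∃ q r : ℚ, a < q ∧ (q:ℝ) < r ∧ (r:ℝ) < b ∧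
      ((∀ y : ℝ, (q:ℝ) < y → y < r → T y) ∨ (∀ y : ℝ, (q:ℝ) < y → y < r → ¬ T y)) := by
  obtain ⟨y, hy, hyf⟩ := ((Set.Ioo_infinite hab).sdiff (finite_frontier hR hT)).nonempty
  have key : ∀ W : Set ℝ, y ∈ interior W → ∃ q r : ℚ, a < q ∧ (q:ℝ) < r ∧ (r:ℝ) < b ∧
      (∀ y : ℝ, (q:ℝ) < y → y < r → y ∈ W) := by
    intro W hW
    have : interior W ∩ Set.Ioo a b ∈ nhds y :=
      Filter.inter_mem (isOpen_interior.mem_nhds hW) (Ioo_mem_nhds hy.1 hy.2)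
    obtain ⟨c, d, hcd, h⟩ := mem_nhds_iff_exists_Ioo_subset.1 this
    obtain ⟨q, hq1, hq2⟩ := exists_rat_btwn hcd.1
    obtain ⟨r, hr1, hr2⟩ := exists_rat_btwn hcd.2
    have e1 : a ≤ c := by
      by_contra hc
      push Not at hc
      obtain ⟨z, hz1, hz2⟩ := exists_between (lt_min hc hcd.1)
      have := (h ⟨hz1, (lt_min_iff.1 hz2).2.trans hcd.2⟩).2.1
      exact absurd this (lt_asymm (lt_min_iff.1 hz2).1)
    have e2 : d ≤ b := by
      by_contra hc
      push Not at hc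
      obtain ⟨z, hz1, hz2⟩ := exists_between (max_lt hc hcd.2)
      have := (h ⟨hcd.1.trans (max_lt_iff.1 hz1).2, hz2⟩).2.2
      exact absurd this (lt_asymm (max_lt_iff.1 hz1).1)
    exact ⟨q, r, by linarith, by linarith, by linarith,
      fun z h1 h2 => interior_subset (h ⟨by linarith, by linarith⟩).1⟩
  have hcases : y ∈ interior {y | T y} ∨ y ∈ interior ({y | T y}ᶜ) := by
    rw [interior_compl]
    by_contra hc
    push Not at hc
    exact hyf ⟨by simpa using hc.2, hc.1⟩
  rcases hcases with h | h
  · obtain ⟨q, r, h1, h2, h3, h4⟩ := key _ h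
    exact ⟨q, r, h1, h2, h3, Or.inl h4⟩
  · obtain ⟨q, r, h1, h2, h3, h4⟩ := key _ h
    exact ⟨q, r, h1, h2, h3, Or.inr h4⟩

theorem box_nhds {n : ℕ} {U : Set (Fin (n+1) → ℝ)} {x : Fin n → ℝ} {y : ℝ}
    (hU : U ∈ nhds (Fin.snoc x y : Fin (n+1) → ℝ)) : ∃ A, IsOpen A ∧ x ∈ A ∧ ∃ a b, a < y ∧ y < b ∧
      ∀ x' ∈ A, ∀ y', a < y' → y' < b → (Fin.snoc x' y' : Fin (n+1) → ℝ) ∈ U := by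
  have hc : Continuous (fun z : (Fin n → ℝ) × ℝ => (Fin.snoc z.1 z.2 : Fin (n+1) → ℝ)) := by
    fun_prop
  have := (hc.tendsto (x, y)) hU
  rw [nhds_prod_eq] at this
  obtain ⟨A, hA, B, hB, h⟩ := Filter.mem_prod_iff.1 this
  obtain ⟨A', hA', hA2, hA3⟩ := mem_nhds_iff.1 hA
  obtain ⟨a, b, hab, h2⟩ := mem_nhds_iff_exists_Ioo_subset.1 hB
  exact ⟨A', hA2, hA3, a, b, hab.1, hab.2, fun x' hx' y' h3 h4 =>
    h (Set.mk_mem_prod (hA' hx') (h2 ⟨h3, h4⟩))⟩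

theorem continuous_init {n : ℕ} : Continuous (fun z : Fin (n+1) → ℝ => (Fin.init z : Fin n → ℝ)) := by
  fun_prop

theorem isOpen_box {n : ℕ} {V : Set (Fin n → ℝ)} (hV : IsOpen V) (a b : ℝ) :
    IsOpen {z : Fin (n+1) → ℝ | (Fin.init z : Fin n → ℝ) ∈ V ∧ a < z (Fin.last n) ∧ z (Fin.last n) < b} := by
  refine (hV.preimage continuous_init).inter (IsOpen.inter ?_ ?_)
  · exact isOpen_lt continuous_const (continuous_apply _)
  · exact isOpen_lt (continuous_apply _) continuous_const

/-- Density implies local containment. -/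
def Sm (L : FirstOrder.Language) [L.Structure ℝ] (n : ℕ) : Prop :=
  ∀ S : (Fin n → ℝ) → Prop, DefP L S → ∀ U : Set (Fin n → ℝ), IsOpen U → U.Nonempty →
    U ⊆ closure {x | S x} → ∃ V, IsOpen V ∧ V.Nonempty ∧ V ⊆ U ∧ ∀ x ∈ V, S x

theorem Sm.bl {n : ℕ} (h : Sm L n) {ι : Type} [Countable ι] {S : ι → (Fin n → ℝ) → Prop}
    (hS : ∀ i, DefP L (S i)) {U : Set (Fin n → ℝ)} (hU : IsOpen U) (hne : U.Nonempty)
    (hc : ∀ x ∈ U, ∃ i, S i x) : ∃ i V, IsOpen V ∧ V.Nonempty ∧ V ⊆ U ∧ ∀ x ∈ V, S i x := by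
  let f : Option ι → Set (Fin n → ℝ) := fun o => o.elim Uᶜ (fun i => closure {x | S i x})
  have hd := dense_iUnion_interior_of_closed (f := f) (fun o => by
    cases o with
    | none => exact hU.isClosed_compl
    | some i => exact isClosed_closure) (by
    ext x
    simp only [Set.mem_iUnion, Set.mem_univ, iff_true]
    by_cases hx : x ∈ U
    · obtain ⟨i, hi⟩ := hc x hx
      exact ⟨some i, subset_closure hi⟩
    · exact ⟨none, hx⟩)
  obtain ⟨x, hxU, hx⟩ := hd.inter_open_nonempty U hU hne
  obtain ⟨o, ho⟩ := Set.mem_iUnion.1 hx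
  cases o with
  | none => exact absurd hxU (interior_subset ho)
  | some i =>
    obtain ⟨V, h1, h2, h3, h4⟩ := h (S i) (hS i) (U ∩ interior (closure {x | S i x}))
      (hU.inter isOpen_interior) ⟨x, hxU, ho⟩ (fun z hz => interior_subset hz.2)
    exact ⟨i, V, h1, h2, h3.trans Set.inter_subset_left, h4⟩

theorem sm (hR : IsOMinimal L ℝ) : ∀ n, Sm L n := by
  intro n
  induction n with
  | zero =>
    intro S hS U hU hne hc
    obtain ⟨x, hx⟩ := hne
    have : (closure {x | S x}).Nonempty := ⟨x, hc hx⟩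
    obtain ⟨y, hy⟩ := closure_nonempty_iff.1 this
    exact ⟨U, hU, ⟨x, hx⟩, le_rfl, fun z _ => by rw [Subsingleton.elim z y]; exact hy⟩
  | succ n ih =>
    intro S hS U hU hne hc
    obtain ⟨z, hz⟩ := hne
    have hz' : U ∈ nhds (Fin.snoc (Fin.init z) (z (Fin.last n)) : Fin (n+1) → ℝ) := by
      rw [Fin.snoc_init_self]; exact hU.mem_nhds hz
    obtain ⟨A, hA, hzA, a, b, ha, hb, hbox⟩ := box_nhds hz'
    let E : ℚ × ℚ × Bool → (Fin n → ℝ) → Prop := fun i x =>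
      (a < i.1 ∧ (i.1:ℝ) < i.2.1 ∧ (i.2.1 : ℝ) < b) ∧
        ∀ y : ℝ, (i.1:ℝ) < y → y < i.2.1 → (S (Fin.snoc x y) ↔ i.2.2 = true)
    have hE : ∀ i, DefP L (E i) := by
      intro i
      refine DefP.and (DefP.cst _) (DefP.all (DefP.imp ?_ (DefP.imp ?_ (DefP.iff ?_ (DefP.cst _)))))
      · exact DefP.lt hR (by fun_prop) (by fun_prop)
      · exact DefP.lt hR (by fun_prop) (by fun_prop)
      · exact hS.comp (f := fun z : (Fin n → ℝ) × ℝ => (Fin.snoc z.1 z.2 : Fin (n+1) → ℝ)) (by fun_prop)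
    obtain ⟨⟨q, r, β⟩, V, hV, ⟨x, hx⟩, hVA, hVE⟩ := ih.bl hE hA ⟨_, hzA⟩ (by
      intro x hx
      have hSx : DefP L (fun y : ℝ => S (Fin.snoc x y)) :=
        hS.comp (f := fun y : ℝ => (Fin.snoc x y : Fin (n+1) → ℝ)) (by fun_prop)
      obtain ⟨q, r, h1, h2, h3, h4 | h4⟩ := exists_ratIoo hR hSx (ha.trans hb)
      · exact ⟨(q, r, true), ⟨h1, h2, h3⟩, fun y h5 h6 => by simpa using h4 y h5 h6⟩
      · exact ⟨(q, r, false), ⟨h1, h2, h3⟩, fun y h5 h6 => by simpa using h4 y h5 h6⟩)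
    obtain ⟨⟨h1, h2, h3⟩, -⟩ := hVE x hx
    simp only at h1 h2 h3
    have hsub : ∀ w : Fin (n+1) → ℝ, w ∈ {z : Fin (n+1) → ℝ | (Fin.init z : Fin n → ℝ) ∈ V ∧
        (q:ℝ) < z (Fin.last n) ∧ z (Fin.last n) < r} → w ∈ U := by
      rintro w ⟨h4, h5, h6⟩
      have := hbox _ (hVA h4) _ (h1.trans h5) (h6.trans h3)
      rwa [Fin.snoc_init_self] at this
    have hmem : ∀ w : Fin (n+1) → ℝ, w ∈ {z : Fin (n+1) → ℝ | (Fin.init z : Fin n → ℝ) ∈ V ∧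
        (q:ℝ) < z (Fin.last n) ∧ z (Fin.last n) < r} → (S w ↔ β = true) := by
      rintro w ⟨h4, h5, h6⟩
      have := (hVE _ h4).2 _ h5 h6
      simpa only [Fin.snoc_init_self] using this
    obtain ⟨y, hy1, hy2⟩ := exists_between h2
    have hw : (Fin.snoc x y : Fin (n+1) → ℝ) ∈ {z : Fin (n+1) → ℝ | (Fin.init z : Fin n → ℝ) ∈ V ∧
        (q:ℝ) < z (Fin.last n) ∧ z (Fin.last n) < r} := by
      simp [hx, hy1, hy2]
    have hβ : β = true := by
      obtain ⟨w, hw1, hw2⟩ := mem_closure_iff.1 (hc (hsub _ hw)) _ (isOpen_box hV q r) hw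
      exact (hmem w hw1).1 hw2
    exact ⟨_, isOpen_box hV q r, ⟨_, hw⟩, hsub, fun w hw => (hmem w hw).2 hβ⟩

theorem bl (hR : IsOMinimal L ℝ) {n : ℕ} {ι : Type} [Countable ι] {S : ι → (Fin n → ℝ) → Prop}
    (hS : ∀ i, DefP L (S i)) {U : Set (Fin n → ℝ)} (hU : IsOpen U) (hne : U.Nonempty)
    (hc : ∀ x ∈ U, ∃ i, S i x) : ∃ i V, IsOpen V ∧ V.Nonempty ∧ V ⊆ U ∧ ∀ x ∈ V, S i x :=
  (sm hR n).bl hS hU hne hc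

/-- A generic point of an open set for countably many definable sets. -/
theorem generic (hR : IsOMinimal L ℝ) {n : ℕ} {ι : Type} [Countable ι] {S : ι → (Fin n → ℝ) → Prop}
    (hS : ∀ i, DefP L (S i)) {U : Set (Fin n → ℝ)} (hU : IsOpen U) (hne : U.Nonempty) :
    ∃ x ∈ U, ∀ i, (∀ᶠ x' in nhds x, S i x') ∨ (∀ᶠ x' in nhds x, ¬ S i x') := by
  by_contra hc
  push Not at hc
  let B : ι → (Fin n → ℝ) → Prop := fun i x =>
    ¬ (∀ᶠ x' in nhds x, S i x') ∧ ¬ (∀ᶠ x' in nhds x, ¬ S i x')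
  have hB : ∀ i, DefP L (B i) := fun i => by
    refine DefP.and (DefP.not (DefP.ev hR ?_ (by fun_prop))) (DefP.not (DefP.ev hR ?_ (by fun_prop)))
    · exact (hS i).comp (f := fun z : (Fin n → ℝ) × (Fin n → ℝ) => z.2) (by fun_prop)
    · exact ((hS i).comp (f := fun z : (Fin n → ℝ) × (Fin n → ℝ) => z.2) (by fun_prop)).not
  obtain ⟨i, V, hV, hVn, hVU, hVB⟩ := bl hR hB hU hne (by
    intro x hx
    obtain ⟨i, h1, h2⟩ := hc x hx
    exact ⟨i, by simpa using h1, by simpa using h2⟩)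
  obtain ⟨W, hW, ⟨w, hw⟩, hWV, hWS⟩ := sm hR n (S i) (hS i) V hV hVn (by
    intro x hx
    have := (hVB x hx).2
    rw [mem_closure_iff_frequently]
    exact fun h => this h)
  exact (hVB w (hWV hw)).1 (by filter_upwards [hW.mem_nhds hw] with x hx using hWS x hx)

end baire

end OM

namespace OM

/-- Counting formula: at least `i` points of `T` below `y`. -/
def CG (T : ℝ → Prop) : ℕ → ℝ → Prop
  | 0, _ => True
  | i + 1, y => ∃ y', y' < y ∧ T y' ∧ CG T i y'

theorem CG.mono {T : ℝ → Prop} : ∀ {i : ℕ} {y y' : ℝ}, y ≤ y' → CG T i y → CG T i y'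
  | 0, _, _, _, _ => trivial
  | _ + 1, _, _, h, ⟨z, h1, h2⟩ => ⟨z, h1.trans_le h, h2⟩

theorem CG.drop {T : ℝ → Prop} : ∀ {i : ℕ} {y y' : ℝ}, (∀ b, y ≤ b → b < y' → ¬ T b) →
    CG T i y' → CG T i y
  | 0, _, _, _, _ => trivial
  | _ + 1, y, _, h, ⟨z, h1, h2, h3⟩ => ⟨z, by
      by_contra hc
      exact h z (not_lt.1 hc) h1 h2, h2, h3⟩

theorem CG.card {T : ℝ → Prop} (hT : {b | T b}.Finite) : ∀ {i : ℕ} {y : ℝ}, CG T i y →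
    i ≤ {b | T b ∧ b < y}.ncard
  | 0, _, _ => Nat.zero_le _
  | i + 1, y, ⟨z, h1, h2, h3⟩ => by
    have ih := CG.card hT h3
    have hf : {b | T b ∧ b < z}.Finite := hT.subset fun b hb => hb.1
    have : insert z {b | T b ∧ b < z} ⊆ {b | T b ∧ b < y} := by
      rintro b (rfl | hb)
      · exact ⟨h2, h1⟩
      · exact ⟨hb.1, hb.2.trans h1⟩
    have h4 := Set.ncard_le_ncard this (hT.subset fun b hb => hb.1)
    rw [Set.ncard_insert_of_notMem (by simp) hf] at h4
    omega

theorem CG.exact {T : ℝ → Prop} (hT : {b | T b}.Finite) {N : ℕ} (hN : {b | T b}.ncard ≤ N) (y : ℝ) :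
    ∃ i, i < N + 1 ∧ CG T i y ∧ ¬ CG T (i+1) y := by
  by_contra hc
  push Not at hc
  have : ∀ i, i ≤ N + 1 → CG T i y := by
    intro i
    induction i with
    | zero => intro _; trivial
    | succ i ih => intro h; exact hc i (by omega) (ih (by omega))
  have h1 := CG.card hT (this (N+1) le_rfl)
  have h2 : {b | T b ∧ b < y}.ncard ≤ {b | T b}.ncard :=
    Set.ncard_le_ncard (fun b hb => hb.1) hT
  omega

theorem CG.uniq {T : ℝ → Prop} {i : ℕ} {y y' : ℝ} (h1 : T y) (h2 : CG T i y)
    (h4 : ¬ CG T (i+1) y') : y' ≤ y := by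
  by_contra hc
  exact h4 ⟨y, not_le.1 hc, h1, h2⟩

section cov
variable {L : FirstOrder.Language} [L.Structure ℝ]

theorem CG.defP (hR : IsOMinimal L ℝ) {X : Type} [DSpace X] {D : X → ℝ → Prop}
    (hD : DefP L (fun z : X × ℝ => D z.1 z.2)) :
    ∀ i, DefP L (fun z : X × ℝ => CG (D z.1) i z.2)
  | 0 => DefP.cst True
  | i + 1 => by
    refine DefP.ex (P := fun (z : X × ℝ) y' => y' < z.2 ∧ D z.1 y' ∧ CG (D z.1) i y') ?_
    refine DefP.and ?_ (DefP.and ?_ ?_)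
    · exact DefP.lt hR (by fun_prop) (by fun_prop)
    · exact DefP.comp2 hD (by fun_prop) (by fun_prop)
    · exact DefP.comp2 (P := fun x y => CG (D x) i y) (CG.defP hR hD i) (by fun_prop) (by fun_prop)

/-- Sets covered by definable open connected sets and low-dimensional patches. -/
inductive Cov (L : FirstOrder.Language) [L.Structure ℝ] (n : ℕ) : Set (Fin n → ℝ) → Prop
  | opn (U : Set (Fin n → ℝ)) : IsOpen U → IsPreconnected U → DefP L (fun x => x ∈ U) → Cov L n U
  | patch (d : ℕ) (hd : d < n) (Γ : (Fin d → ℝ) → (Fin n → ℝ) → Prop) :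
      DefP L (fun z : (Fin d → ℝ) × (Fin n → ℝ) => Γ z.1 z.2) →
      (∀ w x x', Γ w x → Γ w x' → x = x') → Cov L n {x | ∃ w, Γ w x}
  | union (S T : Set (Fin n → ℝ)) : Cov L n S → Cov L n T → Cov L n (S ∪ T)

theorem Cov.empty {n : ℕ} : Cov L n (∅ : Set (Fin n → ℝ)) :=
  Cov.opn _ isOpen_empty isPreconnected_empty (DefP.cst False)

theorem Cov.iUnion {n : ℕ} {S : ℕ → Set (Fin n → ℝ)} (h : ∀ i, Cov L n (S i)) :
    ∀ N : ℕ, Cov L n {x | ∃ i, i < N ∧ x ∈ S i}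
  | 0 => by simpa using Cov.empty
  | N + 1 => by
    have := Cov.union _ _ (Cov.iUnion h N) (h N)
    convert this using 1
    ext x
    simp only [Set.mem_ofPred_eq, Set.mem_union, Nat.lt_succ_iff_lt_or_eq]
    constructor
    · rintro ⟨i, h1 | rfl, h2⟩
      · exact Or.inl ⟨i, h1, h2⟩
      · exact Or.inr h2
    · rintro (⟨i, h1, h2⟩ | h)
      · exact ⟨i, Or.inl h1, h2⟩
      · exact ⟨N, Or.inr rfl, h⟩

/-- Definable sets in dimension `n` are covered. -/
def KK (L : FirstOrder.Language) [L.Structure ℝ] (n : ℕ) : Prop :=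
  ∀ S : (Fin n → ℝ) → Prop, DefP L S → Cov L n {x | S x}

/-- Uniform finiteness. -/
def UF (L : FirstOrder.Language) [L.Structure ℝ] (n : ℕ) : Prop :=
  ∀ D : (Fin n → ℝ) → ℝ → Prop, DefP L (fun z : (Fin n → ℝ) × ℝ => D z.1 z.2) →
    (∀ x, {y | D x y}.Finite) → ∃ N, ∀ x, {y | D x y}.ncard ≤ N

theorem KK.zero : KK L 0 := by
  intro S hS
  refine Cov.opn _ (isOpen_discrete _) (Set.subsingleton_of_subsingleton.isPreconnected) hS

/-- Local triviality of a finite-fibre family. -/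
def Nice {n : ℕ} (D : (Fin n → ℝ) → ℝ → Prop) (x : Fin n → ℝ) : Prop :=
  (∀ y a b : ℝ, a < y → y < b → ∃ q r : ℝ, a ≤ q ∧ q < y ∧ y < r ∧ r ≤ b ∧
    ((∀ᶠ x' in nhds x, ∀ z, q < z → z < r → ¬ D x' z) ∨
     (∀ᶠ x' in nhds x, ∃ z, (q < z ∧ z < r ∧ D x' z) ∧ ∀ z', q < z' → z' < r → D x' z' → z' = z))) ∧
  (∃ r : ℝ, ∀ᶠ x' in nhds x, ∀ z, r < z → ¬ D x' z) ∧
  (∃ q : ℝ, ∀ᶠ x' in nhds x, ∀ z, z < q → ¬ D x' z)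

theorem Nice.defP (hR : IsOMinimal L ℝ) {n : ℕ} {D : (Fin n → ℝ) → ℝ → Prop}
    (hD : DefP L (fun z : (Fin n → ℝ) × ℝ => D z.1 z.2)) : DefP L (Nice D) := by
  unfold Nice
  repeat' first
    | exact DefP.comp2 hD (by fun_prop) (by fun_prop)
    | exact DefP.lt hR (by fun_prop) (by fun_prop)
    | exact DefP.le hR (by fun_prop) (by fun_prop)
    | exact DefP.eq (by fun_prop) (by fun_prop)
    | refine DefP.and ?_ ?_
    | refine DefP.or ?_ ?_
    | refine DefP.not ?_
    | refine DefP.ev hR ?_ (by fun_prop)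
    | refine DefP.imp ?_ ?_
    | refine DefP.ex ?_
    | refine DefP.all ?_

theorem Nice.locconst {n : ℕ} {D : (Fin n → ℝ) → ℝ → Prop}
    (hf : ∀ x, {y | D x y}.Finite) {x : Fin n → ℝ} (hx : Nice D x) :
    ∀ᶠ x' in nhds x, {y | D x' y}.ncard = {y | D x y}.ncard := by
  obtain ⟨h1, ⟨r0, hr0⟩, ⟨q0, hq0⟩⟩ := hx
  obtain ⟨U, hU, hUd⟩ := (hf x).t2_separation
  let W : ℝ → Set ℝ := fun y => U y ∩ ({y | D x y} \ {y})ᶜ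
  have hWo : ∀ y, IsOpen (W y) := fun y =>
    (hU y).2.inter ((hf x).subset Set.sdiff_subset).isClosed.isOpen_compl
  have hWm : ∀ y, y ∈ W y := fun y => ⟨(hU y).1, by simp⟩
  have h2 : ∀ y, ∃ q r : ℝ, q < y ∧ y < r ∧ Set.Ioo q r ⊆ W y ∧
    ((∀ᶠ x' in nhds x, ∀ z, q < z → z < r → ¬ D x' z) ∨
     (∀ᶠ x' in nhds x, ∃ z, (q < z ∧ z < r ∧ D x' z) ∧ ∀ z', q < z' → z' < r → D x' z' → z' = z)) := by
    intro y
    obtain ⟨a, b, hab, hs⟩ := mem_nhds_iff_exists_Ioo_subset.1 ((hWo y).mem_nhds (hWm y))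
    obtain ⟨q, r, e1, e2, e3, e4, e5⟩ := h1 y a b hab.1 hab.2
    exact ⟨q, r, e2, e3, (Set.Ioo_subset_Ioo e1 e4).trans hs, e5⟩
  choose q r hq hr hsub halt using h2
  have hnot : ∀ y, ¬ D x y → ∀ᶠ x' in nhds x, ∀ z, q y < z → z < r y → ¬ D x' z := by
    intro y hy
    rcases halt y with h | h
    · exact h
    · obtain ⟨z, ⟨e1, e2, e3⟩, -⟩ := h.self_of_nhds
      have := (hsub y ⟨e1, e2⟩).2
      by_cases hzy : z = y
      · exact absurd (hzy ▸ e3) hy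
      · exact absurd ⟨e3, hzy⟩ this
  have hyes : ∀ y, D x y → ∀ᶠ x' in nhds x, ∃ z, (q y < z ∧ z < r y ∧ D x' z) ∧
      ∀ z', q y < z' → z' < r y → D x' z' → z' = z := by
    intro y hy
    rcases halt y with h | h
    · exact absurd hy (h.self_of_nhds y (hq y) (hr y))
    · exact h
  obtain ⟨t, ht⟩ := (isCompact_Icc (a := q0) (b := r0)).elim_finite_subcover
    (fun y => Set.Ioo (q y) (r y)) (fun y => isOpen_Ioo)
    (fun y _ => Set.mem_iUnion.2 ⟨y, hq y, hr y⟩)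
  have ev1 : ∀ᶠ x' in nhds x, ∀ y ∈ t, ¬ D x y → ∀ z, q y < z → z < r y → ¬ D x' z := by
    rw [Filter.eventually_all_finset]
    intro y _
    by_cases hy : D x y
    · simp [hy]
    · filter_upwards [hnot y hy] with x' hx' _ using hx'
  have ev2 : ∀ᶠ x' in nhds x, ∀ y ∈ {y | D x y}, ∃ z, (q y < z ∧ z < r y ∧ D x' z) ∧
      ∀ z', q y < z' → z' < r y → D x' z' → z' = z := by
    rw [Filter.eventually_all_finite (hf x)]
    exact hyes
  filter_upwards [ev1, ev2, hr0, hq0] with x' a1 a2 a3 a4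
  choose! f hf1 hf2 using a2
  have himg : {y | D x' y} = f '' {y | D x y} := by
    ext z
    constructor
    · intro hz
      have hz1 : z ∈ Set.Icc q0 r0 :=
        ⟨by by_contra hc; exact a4 z (not_le.1 hc) hz, by by_contra hc; exact a3 z (not_le.1 hc) hz⟩
      obtain ⟨y, hy⟩ := Set.mem_iUnion.1 (ht hz1)
      obtain ⟨hy, hzy⟩ := Set.mem_iUnion.1 hy
      have hDy : D x y := by
        by_contra hc
        exact a1 y hy hc z hzy.1 hzy.2 hz
      exact ⟨y, hDy, (hf2 y hDy z hzy.1 hzy.2 hz).symm⟩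
    · rintro ⟨y, hy, rfl⟩
      exact (hf1 y hy).2.2
  rw [himg]
  refine Set.InjOn.ncard_image ?_
  intro y hy y' hy' he
  by_contra hne
  have hd := hUd hy hy' hne
  refine Set.disjoint_left.1 hd (hsub y ⟨(hf1 y hy).1, (hf1 y hy).2.1⟩).1 ?_
  rw [he]
  exact (hsub y' ⟨(hf1 y' hy').1, (hf1 y' hy').2.1⟩).1

theorem Nice.dense (hR : IsOMinimal L ℝ) {n : ℕ} {D : (Fin n → ℝ) → ℝ → Prop}
    (hD : DefP L (fun z : (Fin n → ℝ) × ℝ => D z.1 z.2))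
    (hf : ∀ x, {y | D x y}.Finite) {U : Set (Fin n → ℝ)} (hU : IsOpen U) (hne : U.Nonempty) :
    ∃ x ∈ U, Nice D x := by
  let S : (ℚ × ℚ) ⊕ (ℚ × ℚ) ⊕ ℚ ⊕ ℚ → (Fin n → ℝ) → Prop := fun i => match i with
    | Sum.inl (q, r) => fun x' => ∀ z : ℝ, (q:ℝ) < z → z < r → ¬ D x' z
    | Sum.inr (Sum.inl (q, r)) => fun x' => ∃ z, ((q:ℝ) < z ∧ z < r ∧ D x' z) ∧
        ∀ z', (q:ℝ) < z' → z' < r → D x' z' → z' = z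
    | Sum.inr (Sum.inr (Sum.inl r)) => fun x' => ∀ z : ℝ, (r:ℝ) < z → ¬ D x' z
    | Sum.inr (Sum.inr (Sum.inr q)) => fun x' => ∀ z : ℝ, z < (q:ℝ) → ¬ D x' z
  have hS : ∀ i, DefP L (S i) := by
    rintro (⟨q, r⟩ | ⟨q, r⟩ | r | q) <;> dsimp only [S]
    all_goals
      repeat' first
        | exact DefP.comp2 hD (by fun_prop) (by fun_prop)
        | exact DefP.lt hR (by fun_prop) (by fun_prop)
        | exact DefP.eq (by fun_prop) (by fun_prop)
        | refine DefP.and ?_ ?_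
        | refine DefP.not ?_
        | refine DefP.imp ?_ ?_
        | refine DefP.ex ?_
        | refine DefP.all ?_
  obtain ⟨x, hxU, hx⟩ := generic hR hS hU hne
  have hx' : ∀ i, S i x → ∀ᶠ x' in nhds x, S i x' := fun i hi => by
    rcases hx i with h | h
    · exact h
    · exact absurd hi h.self_of_nhds
  refine ⟨x, hxU, ?_, ?_, ?_⟩
  · intro y a b ha hb
    have hn : Set.Ioo a b ∩ ({y | D x y} \ {y})ᶜ ∈ nhds y :=
      Filter.inter_mem (Ioo_mem_nhds ha hb)
        (((hf x).subset Set.sdiff_subset).isClosed.isOpen_compl.mem_nhds (by simp))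
    obtain ⟨c, d, hcd, hs⟩ := mem_nhds_iff_exists_Ioo_subset.1 hn
    obtain ⟨q, hq1, hq2⟩ := exists_rat_btwn (max_lt ha hcd.1)
    obtain ⟨r, hr1, hr2⟩ := exists_rat_btwn (lt_min hb hcd.2)
    have hq3 := max_lt_iff.1 hq1
    have hr3 := lt_min_iff.1 hr2
    have honly : ∀ z : ℝ, (q:ℝ) < z → z < r → D x z → z = y := by
      intro z h1 h2 h3
      have := (hs ⟨hq3.2.trans h1, h2.trans hr3.2⟩).2
      by_contra hc
      exact this ⟨h3, hc⟩
    refine ⟨q, r, hq3.1.le, hq2, hr1, hr3.1.le, ?_⟩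
    by_cases hy : D x y
    · exact Or.inr (hx' (Sum.inr (Sum.inl (q, r))) ⟨y, ⟨hq2, hr1, hy⟩, honly⟩)
    · refine Or.inl (hx' (Sum.inl (q, r)) fun z h1 h2 h3 => ?_)
      have := honly z h1 h2 h3
      exact hy (this ▸ h3)
  · obtain ⟨b, hb⟩ := (hf x).bddAbove
    obtain ⟨r, hr⟩ := exists_rat_gt b
    exact ⟨r, hx' (Sum.inr (Sum.inr (Sum.inl r))) fun z h1 h2 => by linarith [hb h2]⟩
  · obtain ⟨b, hb⟩ := (hf x).bddBelow
    obtain ⟨r, hr⟩ := exists_rat_lt b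
    exact ⟨r, hx' (Sum.inr (Sum.inr (Sum.inr r))) fun z h1 h2 => by linarith [hb h2]⟩

theorem UF.step (hR : IsOMinimal L ℝ) {n : ℕ} (hK : KK L n) (hU : ∀ d, d < n → UF L d) : UF L n := by
  intro D hD hf
  have claim : ∀ S, Cov L n S → ((∀ x ∈ S, Nice D x) ∨ (∀ x ∈ S, ¬ Nice D x)) →
      ∃ N, ∀ x ∈ S, {y | D x y}.ncard ≤ N := by
    intro S hS
    induction hS with
    | opn U ho hc hdef =>
      rintro (h | h)
      · rcases U.eq_empty_or_nonempty with rfl | ⟨x0, hx0⟩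
        · exact ⟨0, by simp⟩
        · refine ⟨{y | D x0 y}.ncard, fun x hx => le_of_eq ?_⟩
          refine hc.constant (f := fun x => {y | D x y}.ncard) ?_ hx hx0
          intro z hz
          refine ContinuousAt.continuousWithinAt ?_
          refine tendsto_nhds_of_eventually_eq ?_
          exact Nice.locconst hf (h z hz)
      · refine ⟨0, fun x hx => ?_⟩
        obtain ⟨z, hz, hz2⟩ := Nice.dense hR hD hf ho ⟨x, hx⟩
        exact absurd hz2 (h z hz)
    | patch d hd Γ hΓ hfun =>
      intro _
      obtain ⟨N, hN⟩ := hU d hd (fun w y => ∃ x, Γ w x ∧ D x y) (by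
        refine DefP.ex (DefP.and ?_ ?_)
        · exact DefP.comp2 hΓ (by fun_prop) (by fun_prop)
        · exact DefP.comp2 hD (by fun_prop) (by fun_prop)) (by
        intro w
        by_cases hw : ∃ x, Γ w x
        · obtain ⟨x, hx⟩ := hw
          refine (hf x).subset ?_
          rintro y ⟨x', h1, h2⟩
          rw [hfun w x x' hx h1]
          exact h2
        · convert Set.finite_empty
          ext y
          simp only [Set.mem_ofPred_eq, Set.mem_empty_iff_false, iff_false]
          rintro ⟨x, h1, -⟩
          exact hw ⟨x, h1⟩)
      refine ⟨N, ?_⟩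
      rintro x ⟨w, hw⟩
      have := hN w
      have he : {y | ∃ x, Γ w x ∧ D x y} = {y | D x y} := by
        ext y
        constructor
        · rintro ⟨x', h1, h2⟩
          rw [hfun w x x' hw h1]
          exact h2
        · intro h
          exact ⟨x, hw, h⟩
      rwa [he] at this
    | union S T _ _ ihS ihT =>
      intro h
      obtain ⟨N1, h1⟩ := ihS (h.imp (fun h x hx => h x (Or.inl hx)) (fun h x hx => h x (Or.inl hx)))
      obtain ⟨N2, h2⟩ := ihT (h.imp (fun h x hx => h x (Or.inr hx)) (fun h x hx => h x (Or.inr hx)))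
      refine ⟨max N1 N2, ?_⟩
      rintro x (hx | hx)
      · exact (h1 x hx).trans (le_max_left _ _)
      · exact (h2 x hx).trans (le_max_right _ _)
  have hn := Nice.defP hR hD
  obtain ⟨N1, h1⟩ := claim _ (hK _ hn) (Or.inl fun x hx => hx)
  obtain ⟨N2, h2⟩ := claim _ (hK _ hn.not) (Or.inr fun x hx => hx)
  refine ⟨max N1 N2, fun x => ?_⟩
  by_cases hx : Nice D x
  · exact (h1 x hx).trans (le_max_left _ _)
  · exact (h2 x hx).trans (le_max_right _ _)

end cov

end OM

namespace OM

/-- Frontier points of a subset of the line. -/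
def FrP (T : ℝ → Prop) (y : ℝ) : Prop :=
  ¬ (∃ a b : ℝ, a < y ∧ y < b ∧ ∀ z, a < z → z < b → T z) ∧
  ¬ (∃ a b : ℝ, a < y ∧ y < b ∧ ∀ z, a < z → z < b → ¬ T z)

theorem frP_iff {T : ℝ → Prop} {y : ℝ} : FrP T y ↔ y ∈ frontier {y | T y} := by
  have key : ∀ T : ℝ → Prop, (∃ a b : ℝ, a < y ∧ y < b ∧ ∀ z, a < z → z < b → T z) ↔
      y ∈ interior {y | T y} := by
    intro T
    rw [mem_interior_iff_mem_nhds, mem_nhds_iff_exists_Ioo_subset]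
    constructor
    · rintro ⟨a, b, h1, h2, h3⟩
      exact ⟨a, b, ⟨h1, h2⟩, fun z hz => h3 z hz.1 hz.2⟩
    · rintro ⟨a, b, h1, h2⟩
      exact ⟨a, b, h1.1, h1.2, fun z e1 e2 => h2 ⟨e1, e2⟩⟩
  unfold FrP
  rw [key T, key (fun z => ¬ T z)]
  have : interior {y | ¬ T y} = (closure {y | T y})ᶜ := by
    rw [← interior_compl]; rfl
  rw [this, frontier]
  simp only [Set.mem_compl_iff, not_not, Set.mem_sdiff]
  tauto

theorem frP_const {T : ℝ → Prop} {y y' : ℝ} (h : y ≤ y')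
    (hn : ∀ z, y ≤ z → z ≤ y' → ¬ FrP T z) : T y ↔ T y' := by
  classical
  have := (isPreconnected_Icc (a := y) (b := y')).constant (f := fun z => decide (T z)) (by
    intro z hz
    refine ContinuousAt.continuousWithinAt (tendsto_nhds_of_eventually_eq ?_)
    have h1 := hn z hz.1 hz.2
    unfold FrP at h1
    rw [not_and_or, not_not, not_not] at h1
    rcases h1 with ⟨a, b, h2, h3, h4⟩ | ⟨a, b, h2, h3, h4⟩
    · filter_upwards [Ioo_mem_nhds h2 h3] with w hw
      simp [h4 w hw.1 hw.2, h4 z h2 h3]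
    · filter_upwards [Ioo_mem_nhds h2 h3] with w hw
      simp [h4 w hw.1 hw.2, h4 z h2 h3]) (Set.left_mem_Icc.2 h) (Set.right_mem_Icc.2 h)
  simpa using this

section kk
variable {L : FirstOrder.Language} [L.Structure ℝ]

theorem frP_finite (hR : IsOMinimal L ℝ) {T : ℝ → Prop} (hT : DefP L T) : {y | FrP T y}.Finite := by
  refine (finite_frontier hR hT).subset fun y hy => frP_iff.1 hy

theorem frP_defP (hR : IsOMinimal L ℝ) {X : Type} [DSpace X] {D : X → ℝ → Prop}
    (hD : DefP L (fun z : X × ℝ => D z.1 z.2)) : DefP L (fun z : X × ℝ => FrP (D z.1) z.2) := by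
  unfold FrP
  repeat' first
    | exact DefP.comp2 hD (by fun_prop) (by fun_prop)
    | exact DefP.lt hR (by fun_prop) (by fun_prop)
    | refine DefP.and ?_ ?_
    | refine DefP.not ?_
    | refine DefP.imp ?_ ?_
    | refine DefP.ex ?_
    | refine DefP.all ?_

theorem cov_band (hR : IsOMinimal L ℝ) {n : ℕ} (hK : KK L n) {Bd : (Fin n → ℝ) → ℝ → Prop}
    (hB : DefP L (fun z : (Fin n → ℝ) × ℝ => Bd z.1 z.2))
    (ho : ∀ x, IsOpen {y | Bd x y})
    (hc : ∀ x, IsPreconnected {y | Bd x y}) :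
    Cov L (n+1) {z | Bd (Fin.init z) (z (Fin.last n))} := by
  let A : (Fin n → ℝ) → Prop := fun x => ∃ y, Bd x y
  let G : (Fin n → ℝ) → Prop := fun x => A x ∧ ∀ y, Bd x y →
    ∀ᶠ z in nhds (Fin.snoc x y : Fin (n+1) → ℝ), Bd (Fin.init z) (z (Fin.last n))
  let H : (Fin n → ℝ) → Prop := fun x => A x ∧ ¬ G x
  have hA : DefP L A := DefP.ex hB
  have hG : DefP L G := by
    refine hA.and (DefP.all (DefP.imp hB (DefP.ev hR ?_ ?_)))
    · exact DefP.comp2 hB (by fun_prop) (by fun_prop)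
    · fun_prop
  have hH : DefP L H := hA.and hG.not
  have hHn : ∀ U : Set (Fin n → ℝ), IsOpen U → U.Nonempty → ∃ x ∈ U, ¬ H x := by
    intro U hU hne
    let S : ℚ × ℚ → (Fin n → ℝ) → Prop := fun i x => ∀ y : ℝ, (i.1:ℝ) ≤ y → y ≤ i.2 → Bd x y
    have hS : ∀ i, DefP L (S i) := fun i => by
      refine DefP.all (DefP.imp ?_ (DefP.imp ?_ hB))
      · exact DefP.le hR (by fun_prop) (by fun_prop)
      · exact DefP.le hR (by fun_prop) (by fun_prop)
    obtain ⟨x, hxU, hx⟩ := generic hR hS hU hne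
    refine ⟨x, hxU, fun hx2 => hx2.2 ⟨hx2.1, fun y hy => ?_⟩⟩
    obtain ⟨a, b, hab, hs⟩ := mem_nhds_iff_exists_Ioo_subset.1 ((ho x).mem_nhds hy)
    obtain ⟨q, hq1, hq2⟩ := exists_rat_btwn hab.1
    obtain ⟨r, hr1, hr2⟩ := exists_rat_btwn hab.2
    have hSx : S (q, r) x := fun z h1 h2 => hs ⟨hq1.trans_le h1, h2.trans_lt hr2⟩
    rcases hx (q, r) with h | h
    · obtain ⟨V, hV, hVo, hxV⟩ := eventually_nhds_iff.1 h
      have : {z : Fin (n+1) → ℝ | (Fin.init z : Fin n → ℝ) ∈ V ∧ (q:ℝ) < z (Fin.last n) ∧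
          z (Fin.last n) < r} ∈ nhds (Fin.snoc x y : Fin (n+1) → ℝ) :=
        (isOpen_box hVo q r).mem_nhds (by simp [hxV, hq2, hr1])
      filter_upwards [this] with z hz
      exact hV _ hz.1 _ hz.2.1.le hz.2.2.le
    · exact absurd hSx h.self_of_nhds
  have claim : ∀ S, Cov L n S → ((∀ x ∈ S, G x) ∨ (∀ x ∈ S, H x)) →
      Cov L (n+1) {z | (Fin.init z : Fin n → ℝ) ∈ S ∧ Bd (Fin.init z) (z (Fin.last n))} := by
    intro S hS
    induction hS with
    | opn U hUo hUc hUd =>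
      rintro (h | h)
      · refine Cov.opn _ ?_ ?_ ?_
        · rw [isOpen_iff_mem_nhds]
          rintro z ⟨hz1, hz2⟩
          have h1 := (h _ hz1).2 _ hz2
          rw [Fin.snoc_init_self] at h1
          filter_upwards [h1, (hUo.preimage continuous_init).mem_nhds hz1] with w h2 h3
          exact ⟨h3, h2⟩
        · intro u v hu hv huv hu1 hv1
          let u' : Set (Fin n → ℝ) := {x | x ∈ U ∧ ∃ y, Bd x y ∧ (Fin.snoc x y : Fin (n+1) → ℝ) ∈ u}
          let v' : Set (Fin n → ℝ) := {x | x ∈ U ∧ ∃ y, Bd x y ∧ (Fin.snoc x y : Fin (n+1) → ℝ) ∈ v}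
          have hop : ∀ u : Set (Fin (n+1) → ℝ), IsOpen u →
              IsOpen {x | x ∈ U ∧ ∃ y, Bd x y ∧ (Fin.snoc x y : Fin (n+1) → ℝ) ∈ u} := by
            intro u hu
            rw [isOpen_iff_mem_nhds]
            rintro x ⟨hx1, y, hy1, hy2⟩
            have h1 := (h _ hx1).2 _ hy1
            obtain ⟨O, hO, hxO, a, b, ha, hb, hbox⟩ := box_nhds (Filter.inter_mem h1 (hu.mem_nhds hy2))
            filter_upwards [hO.mem_nhds hxO, hUo.mem_nhds hx1] with x' h2 h3
            have h4 := hbox x' h2 y ha hb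
            refine ⟨h3, y, ?_, h4.2⟩
            simpa using h4.1
          have hcase : ∀ x ∈ U, ∀ y, Bd x y → (Fin.snoc x y : Fin (n+1) → ℝ) ∈ u ∪ v := by
            intro x hx y hy
            exact huv ⟨by simpa using hx, by simpa using hy⟩
          obtain ⟨x, hxU, hxu, hxv⟩ := hUc u' v' (hop u hu) (hop v hv) (by
            intro x hx
            obtain ⟨y, hy⟩ := (h x hx).1
            rcases hcase x hx y hy with h1 | h1
            · exact Or.inl ⟨hx, y, hy, h1⟩
            · exact Or.inr ⟨hx, y, hy, h1⟩) (by
            obtain ⟨z, ⟨h1, h2⟩, h3⟩ := hu1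
            exact ⟨Fin.init z, h1, h1, z (Fin.last n), h2, by rwa [Fin.snoc_init_self]⟩) (by
            obtain ⟨z, ⟨h1, h2⟩, h3⟩ := hv1
            exact ⟨Fin.init z, h1, h1, z (Fin.last n), h2, by rwa [Fin.snoc_init_self]⟩)
          have hcs : Continuous (fun y : ℝ => (Fin.snoc x y : Fin (n+1) → ℝ)) := by fun_prop
          obtain ⟨y, hy, hyu, hyv⟩ := hc x _ _ (hu.preimage hcs) (hv.preimage hcs)
            (fun y hy => hcase x hxU y hy)
            (by obtain ⟨_, y, h1, h2⟩ := hxu; exact ⟨y, h1, h2⟩)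
            (by obtain ⟨_, y, h1, h2⟩ := hxv; exact ⟨y, h1, h2⟩)
          exact ⟨Fin.snoc x y, ⟨by simpa using hxU, by simpa using hy⟩, hyu, hyv⟩
        · refine DefP.and ?_ ?_
          · exact hUd.comp (by fun_prop)
          · exact DefP.comp2 hB (by fun_prop) (by fun_prop)
      · have : U = ∅ := by
          by_contra hne
          obtain ⟨x, hx, hx2⟩ := hHn U hUo (Set.nonempty_iff_ne_empty.2 hne)
          exact hx2 (h x hx)
        subst this
        simpa using Cov.empty
    | patch d hd Γ hΓ hfun =>
      intro _
      have := Cov.patch (L := L) (n := n+1) (d+1) (by omega)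
        (fun w z => Γ (Fin.init w) (Fin.init z) ∧ w (Fin.last d) = z (Fin.last n) ∧
          Bd (Fin.init z) (z (Fin.last n))) (by
          refine DefP.and ?_ (DefP.and ?_ ?_)
          · exact DefP.comp2 hΓ (by fun_prop) (by fun_prop)
          · exact DefP.eq (by fun_prop) (by fun_prop)
          · exact DefP.comp2 hB (by fun_prop) (by fun_prop)) (by
          rintro w x x' ⟨h1, h2, -⟩ ⟨h3, h4, -⟩
          rw [← Fin.snoc_init_self x, ← Fin.snoc_init_self x', hfun _ _ _ h1 h3, ← h2, ← h4])
      convert this using 1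
      ext z
      constructor
      · rintro ⟨⟨w, hw⟩, hz⟩
        exact ⟨Fin.snoc w (z (Fin.last n)), by simpa using hw, by simp, hz⟩
      · rintro ⟨w, h1, h2, h3⟩
        exact ⟨⟨Fin.init w, h1⟩, h3⟩
    | union S T _ _ ihS ihT =>
      intro h
      have h1 := ihS (h.imp (fun h x hx => h x (Or.inl hx)) (fun h x hx => h x (Or.inl hx)))
      have h2 := ihT (h.imp (fun h x hx => h x (Or.inr hx)) (fun h x hx => h x (Or.inr hx)))
      convert Cov.union _ _ h1 h2 using 1
      ext z
      simp only [Set.mem_ofPred_eq, Set.mem_union]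
      tauto
  have c1 := claim _ (hK _ hG) (Or.inl fun x hx => hx)
  have c2 := claim _ (hK _ hH) (Or.inr fun x hx => hx)
  convert Cov.union _ _ c1 c2 using 1
  ext z
  simp only [Set.mem_ofPred_eq, Set.mem_union]
  constructor
  · intro h
    by_cases hg : G (Fin.init z)
    · exact Or.inl ⟨hg, h⟩
    · exact Or.inr ⟨⟨⟨_, h⟩, hg⟩, h⟩
  · rintro (h | h) <;> exact h.2

theorem KK.step (hR : IsOMinimal L ℝ) {n : ℕ} (hK : KK L n) (hU : UF L n) : KK L (n+1) := by
  intro V hV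
  let T : (Fin n → ℝ) → ℝ → Prop := fun x y => V (Fin.snoc x y)
  have hT : DefP L (fun z : (Fin n → ℝ) × ℝ => T z.1 z.2) :=
    hV.comp (f := fun z : (Fin n → ℝ) × ℝ => (Fin.snoc z.1 z.2 : Fin (n+1) → ℝ)) (by fun_prop)
  have hTx : ∀ x, DefP L (T x) := fun x => DefP.comp2 hT (by fun_prop) (by fun_prop)
  let F : (Fin n → ℝ) → ℝ → Prop := fun x => FrP (T x)
  have hF : DefP L (fun z : (Fin n → ℝ) × ℝ => F z.1 z.2) := frP_defP hR hT
  have hFf : ∀ x, {y | F x y}.Finite := fun x => frP_finite hR (hTx x)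
  obtain ⟨N, hN⟩ := hU F hF hFf
  have hC : ∀ i, DefP L (fun z : (Fin n → ℝ) × ℝ => (fun x y => CG (F x) i y) z.1 z.2) :=
    fun i => CG.defP hR hF i
  have hpatch : ∀ i, Cov L (n+1) {z | ∃ w : Fin n → ℝ, w = Fin.init z ∧ V z ∧
      F (Fin.init z) (z (Fin.last n)) ∧ CG (F (Fin.init z)) i (z (Fin.last n)) ∧
      ¬ CG (F (Fin.init z)) (i+1) (z (Fin.last n))} := by
    intro i
    refine Cov.patch n (by omega) (fun w z => w = Fin.init z ∧ V z ∧
      F (Fin.init z) (z (Fin.last n)) ∧ CG (F (Fin.init z)) i (z (Fin.last n)) ∧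
      ¬ CG (F (Fin.init z)) (i+1) (z (Fin.last n))) ?_ ?_
    · refine DefP.and ?_ (DefP.and ?_ (DefP.and ?_ (DefP.and ?_ (DefP.not ?_))))
      · exact DefP.eqPi (by fun_prop) (by fun_prop)
      · exact hV.comp (by fun_prop)
      · exact DefP.comp2 hF (by fun_prop) (by fun_prop)
      · exact DefP.comp2 (P := fun x y => CG (F x) i y) (hC i) (by fun_prop) (by fun_prop)
      · exact DefP.comp2 (P := fun x y => CG (F x) (i+1) y) (hC (i+1)) (by fun_prop) (by fun_prop)
    · rintro w x x' ⟨h1, -, h2, h3, h4⟩ ⟨h1', -, h2', h3', h4'⟩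
      rw [← h1] at h2 h3 h4
      rw [← h1'] at h2' h3' h4'
      rw [← Fin.snoc_init_self x, ← Fin.snoc_init_self x', ← h1, ← h1',
        le_antisymm (CG.uniq h2' h3' h4) (CG.uniq h2 h3 h4')]
  have hband : ∀ i, Cov L (n+1) {z | (fun x y => T x y ∧ ¬ F x y ∧ CG (F x) i y ∧
      ¬ CG (F x) (i+1) y) (Fin.init z) (z (Fin.last n))} := by
    intro i
    refine cov_band (Bd := fun x y => T x y ∧ ¬ F x y ∧ CG (F x) i y ∧ ¬ CG (F x) (i+1) y)
      hR hK ?_ ?_ ?_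
    · exact hT.and (hF.not.and ((hC i).and (hC (i+1)).not))
    · intro x
      rw [isOpen_iff_mem_nhds]
      rintro y ⟨h1, h2, h3, h4⟩
      have hnb := (hFf x).isClosed.isOpen_compl.mem_nhds h2
      obtain ⟨a, b, hab, hs⟩ := mem_nhds_iff_exists_Ioo_subset.1 hnb
      filter_upwards [Ioo_mem_nhds hab.1 hab.2] with z hz
      have hns : ∀ w, a < w → w < b → ¬ F x w := fun w e1 e2 => hs ⟨e1, e2⟩
      rcases le_total y z with hyz | hyz
      · refine ⟨?_, hns z hz.1 hz.2, h3.mono hyz, fun h5 => h4 (h5.drop ?_)⟩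
        · exact (frP_const hyz fun w e1 e2 => hns w (hab.1.trans_le e1) (e2.trans_lt hz.2)).1 h1
        · exact fun w e1 e2 => hns w (hab.1.trans_le e1) (e2.trans hz.2)
      · refine ⟨?_, hns z hz.1 hz.2, h3.drop ?_, fun h5 => h4 (h5.mono hyz)⟩
        · exact (frP_const hyz fun w e1 e2 => hns w (hz.1.trans_le e1) (e2.trans_lt hab.2)).2 h1
        · exact fun w e1 e2 => hns w (hz.1.trans_le e1) (e2.trans hab.2)
    · intro x
      refine Set.OrdConnected.isPreconnected ⟨?_⟩
      rintro y ⟨h1, h2, h3, h4⟩ y' ⟨h1', h2', h3', h4'⟩ z hz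
      have hno : ∀ w, y ≤ w → w ≤ y' → ¬ F x w := by
        intro w e1 e2 hw
        rcases eq_or_lt_of_le e2 with rfl | e2
        · exact h2' hw
        · exact h4' ⟨w, e2, hw, h3.mono e1⟩
      refine ⟨?_, hno z hz.1 hz.2, h3.mono hz.1, fun h => h4' (h.mono hz.2)⟩
      exact (frP_const hz.1 fun w e1 e2 => hno w e1 (e2.trans hz.2)).1 h1
  have := Cov.iUnion (fun i => Cov.union _ _ (hpatch i) (hband i)) (N+1)
  convert this using 1
  ext z
  have hz : T (Fin.init z) (z (Fin.last n)) ↔ V z := by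
    simp only [T, Fin.snoc_init_self]
  constructor
  · intro h
    obtain ⟨i, h1, h2, h3⟩ := CG.exact (hFf (Fin.init z)) (hN _) (z (Fin.last n))
    refine ⟨i, h1, ?_⟩
    by_cases hFz : F (Fin.init z) (z (Fin.last n))
    · exact Or.inl ⟨_, rfl, h, hFz, h2, h3⟩
    · exact Or.inr ⟨hz.2 h, hFz, h2, h3⟩
  · rintro ⟨i, -, ⟨w, -, h, -⟩ | ⟨h, -⟩⟩
    · exact h
    · exact hz.1 h

theorem kk_uf (hR : IsOMinimal L ℝ) : ∀ n, KK L n ∧ UF L n := by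
  intro n
  induction n using Nat.strong_induction_on with
  | _ n ih =>
    have hK : KK L n := by
      cases n with
      | zero => exact KK.zero
      | succ n => exact KK.step hR (ih n (by omega)).1 (ih n (by omega)).2
    exact ⟨hK, UF.step hR hK fun d hd => (ih d hd).2⟩

end kk

end OM

namespace OM

/-- An initial segment of a total preorder. -/
structure Cut {α : Type} (Ω : α → Prop) (R : α → α → Prop) (C : α → Prop) : Prop where
  tot : ∀ u v, Ω u → Ω v → R u v ∨ R v u
  trans : ∀ u v w, Ω u → Ω v → Ω w → R u v → R v w → R u w
  sub : ∀ u, C u → Ω u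
  down : ∀ u v, Ω u → C v → R u v → C u

theorem Cut.op {α : Type} {Ω : α → Prop} {R : α → α → Prop} {C : α → Prop} (h : Cut Ω R C) :
    Cut Ω (fun u v => R v u) (fun u => Ω u ∧ ¬ C u) where
  tot u v hu hv := h.tot v u hv hu
  trans u v w hu hv hw h1 h2 := h.trans w v u hw hv hu h2 h1
  sub _ hu := hu.1
  down u v hu hv h1 := ⟨hu, fun hc => hv.2 (h.down v u hv.1 hc h1)⟩

/-- Auxiliary set. -/
def II {n : ℕ} (Ω : (Fin n → ℝ) → Prop) (R : (Fin n → ℝ) → (Fin n → ℝ) → Prop)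
    (u c : Fin n → ℝ) : Prop :=
  Ω c ∧ R u c ∧ ¬ (∀ᶠ v in nhds u, ¬ (Ω v ∧ ¬ R v c))

/-- The auxiliary set has interior. -/
def JJ {n : ℕ} (Ω : (Fin n → ℝ) → Prop) (R : (Fin n → ℝ) → (Fin n → ℝ) → Prop)
    (u : Fin n → ℝ) : Prop := ∃ c, ∀ᶠ c' in nhds c, II Ω R u c'

theorem inter_frontier {α : Type} [TopologicalSpace α] {U C : Set α} (hU : IsPreconnected U)
    {x y : α} (hx : x ∈ U) (hxC : x ∈ C) (hy : y ∈ U) (hyC : y ∉ C) : (U ∩ frontier C).Nonempty := by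
  by_contra hne
  have hcov : ∀ z ∈ U, z ∈ interior C ∨ z ∈ (closure C)ᶜ := by
    intro z hz
    by_contra hc
    push Not at hc
    exact hne ⟨z, hz, by simpa using hc.2, hc.1⟩
  obtain ⟨z, -, hz1, hz2⟩ := hU (interior C) ((closure C)ᶜ) isOpen_interior
    isClosed_closure.isOpen_compl hcov
    ⟨x, hx, (hcov x hx).resolve_right fun h => h (subset_closure hxC)⟩
    ⟨y, hy, (hcov y hy).resolve_left fun h => hyC (interior_subset h)⟩
  exact hz2 (subset_closure (interior_subset hz1))

section cuts
variable {L : FirstOrder.Language} [L.Structure ℝ]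

theorem II.defP (hR : IsOMinimal L ℝ) {n : ℕ} {Ω : (Fin n → ℝ) → Prop}
    {R : (Fin n → ℝ) → (Fin n → ℝ) → Prop} (hΩ : DefP L Ω)
    (hRR : DefP L (fun z : (Fin n → ℝ) × (Fin n → ℝ) => R z.1 z.2)) :
    DefP L (fun z : (Fin n → ℝ) × (Fin n → ℝ) => II Ω R z.1 z.2) := by
  refine DefP.and ?_ (DefP.and hRR (DefP.not (DefP.ev hR (DefP.not (DefP.and ?_ (DefP.not ?_))) ?_)))
  · exact hΩ.comp (by fun_prop)
  · exact hΩ.comp (by fun_prop)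
  · exact DefP.comp2 hRR (by fun_prop) (by fun_prop)
  · fun_prop

theorem JJ.defP (hR : IsOMinimal L ℝ) {n : ℕ} {Ω : (Fin n → ℝ) → Prop}
    {R : (Fin n → ℝ) → (Fin n → ℝ) → Prop} (hΩ : DefP L Ω)
    (hRR : DefP L (fun z : (Fin n → ℝ) × (Fin n → ℝ) => R z.1 z.2)) :
    DefP L (JJ Ω R) := by
  refine DefP.ex (DefP.ev hR ?_ ?_)
  · exact DefP.comp2 (II.defP hR hΩ hRR) (by fun_prop) (by fun_prop)
  · fun_prop

theorem JJ.codense (hR : IsOMinimal L ℝ) {n : ℕ} {Ω : (Fin n → ℝ) → Prop}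
    {R : (Fin n → ℝ) → (Fin n → ℝ) → Prop} (hΩ : DefP L Ω)
    (hRR : DefP L (fun z : (Fin n → ℝ) × (Fin n → ℝ) => R z.1 z.2))
    {U : Set (Fin n → ℝ)} (hU : IsOpen U) (hne : U.Nonempty) : ∃ x ∈ U, ¬ JJ Ω R x := by
  by_contra hc
  push Not at hc
  let S : (Fin n → ℚ) × (Fin n → ℚ) → (Fin n → ℝ) → Prop := fun i u =>
    (∀ j, i.1 j < i.2 j) ∧ ∀ c : Fin n → ℝ, (∀ j, (i.1 j : ℝ) < c j ∧ c j < i.2 j) → II Ω R u c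
  have hS : ∀ i, DefP L (S i) := fun i => by
    refine (DefP.cst _).and (DefP.all (DefP.imp (DefP.allF fun j => DefP.and ?_ ?_)
      (II.defP hR hΩ hRR)))
    · exact DefP.lt hR (by fun_prop) (by fun_prop)
    · exact DefP.lt hR (by fun_prop) (by fun_prop)
  obtain ⟨⟨l, r⟩, V, hV, ⟨x, hx⟩, hVU, hVS⟩ := bl hR hS hU hne (by
    intro u hu
    obtain ⟨c, hc⟩ := hc u hu
    obtain ⟨ε, hε, h⟩ := Metric.eventually_nhds_iff.1 hc
    choose l hl1 hl2 using fun j => exists_rat_btwn (show c j - ε/2 < c j by linarith)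
    choose r hr1 hr2 using fun j => exists_rat_btwn (show c j < c j + ε/2 by linarith)
    refine ⟨(l, r), fun j => by exact_mod_cast (hl2 j).trans (hr1 j), fun c' hc' => h ?_⟩
    refine lt_of_le_of_lt ((dist_pi_le_iff (by linarith : (0:ℝ) ≤ ε/2)).2 fun i => ?_)
      (by linarith : ε/2 < ε)
    rw [Real.dist_eq, abs_le]
    constructor <;> linarith [(hc' i).1, (hc' i).2, hl1 i, hr2 i])
  have hlr := (hVS x hx).1
  choose q hq1 hq2 using fun j => exists_between (show ((l j : ℚ) : ℝ) < r j by exact_mod_cast hlr j)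
  have hall : ∀ u ∈ V, II Ω R u q := fun u hu => (hVS u hu).2 q fun j => ⟨hq1 j, hq2 j⟩
  refine (hall x hx).2.2 ?_
  filter_upwards [hV.mem_nhds hx] with v hv h
  exact h.2 (hall v hv).2.1

theorem JJ.key (hR : IsOMinimal L ℝ) {n : ℕ} {Ω C : (Fin n → ℝ) → Prop}
    {R : (Fin n → ℝ) → (Fin n → ℝ) → Prop} (hΩ : DefP L Ω)
    (hRR : DefP L (fun z : (Fin n → ℝ) × (Fin n → ℝ) => R z.1 z.2)) (hcut : Cut Ω R C)
    (hC : ¬ DefP L C)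
    (h2 : ∀ c d, C c → Ω d → ¬ C d → ∃ e, ∀ᶠ e' in nhds e, Ω e' ∧ R c e' ∧ R e' d)
    {u : Fin n → ℝ} (hu : C u) (hcl : ¬ ∀ᶠ v in nhds u, ¬ (Ω v ∧ ¬ C v)) : JJ Ω R u := by
  have hrefl : ∀ v, Ω v → R v v := fun v hv => (hcut.tot v v hv hv).elim id id
  have hΩu := hcut.sub u hu
  by_cases hall : ∀ c, II Ω R u c → C c
  · exfalso
    refine hC ?_
    have : DefP L (fun v => Ω v ∧ ∃ c, II Ω R u c ∧ R v c) := by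
      refine hΩ.and (DefP.ex (DefP.and ?_ hRR))
      exact DefP.comp2 (II.defP hR hΩ hRR) (by fun_prop) (by fun_prop)
    refine this.cgr fun v => ⟨?_, ?_⟩
    · rintro ⟨h3, c, h4, h5⟩
      exact hcut.down v c h3 (hall c h4) h5
    · intro hv
      have hΩv := hcut.sub v hv
      refine ⟨hΩv, ?_⟩
      have aux : ∀ c, C c → R u c → II Ω R u c := by
        intro c hc huc
        refine ⟨hcut.sub c hc, huc, fun h => hcl ?_⟩
        filter_upwards [h] with w hw hw2
        exact hw ⟨hw2.1, fun h3 => hw2.2 (hcut.down w c hw2.1 hc h3)⟩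
      rcases hcut.tot u v hΩu hΩv with h3 | h3
      · exact ⟨v, aux v hv h3, hrefl v hΩv⟩
      · exact ⟨u, aux u hu (hrefl u hΩu), h3⟩
  · push Not at hall
    obtain ⟨d, hd, hdC⟩ := hall
    obtain ⟨e, he⟩ := h2 u d hu hd.1 hdC
    refine ⟨e, ?_⟩
    filter_upwards [he] with e' h3
    refine ⟨h3.1, h3.2.1, fun h => hd.2.2 ?_⟩
    filter_upwards [h] with v hv hv2
    exact hv ⟨hv2.1, fun h4 => hv2.2 (hcut.trans v e' d hv2.1 h3.1 hd.1 h4 h3.2.2)⟩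

/-- Cuts are definable. -/
def Cuts (L : FirstOrder.Language) [L.Structure ℝ] (n : ℕ) : Prop :=
  ∀ (Ω : (Fin n → ℝ) → Prop) (R : (Fin n → ℝ) → (Fin n → ℝ) → Prop) (C : (Fin n → ℝ) → Prop),
    DefP L Ω → DefP L (fun z : (Fin n → ℝ) × (Fin n → ℝ) => R z.1 z.2) → Cut Ω R C → DefP L C

theorem cut_cov (hR : IsOMinimal L ℝ) {n : ℕ} (ih : ∀ d, d < n → Cuts L d)
    {Ω C : (Fin n → ℝ) → Prop}
    {R : (Fin n → ℝ) → (Fin n → ℝ) → Prop} (hΩ : DefP L Ω)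
    (hRR : DefP L (fun z : (Fin n → ℝ) × (Fin n → ℝ) => R z.1 z.2)) (hcut : Cut Ω R C)
    {E : (Fin n → ℝ) → Prop} (hE : DefP L E)
    (hop : ∀ U : Set (Fin n → ℝ), IsOpen U → IsPreconnected U → DefP L (fun x => x ∈ U) →
      (∀ x ∈ U, E x) → DefP L (fun x => C x ∧ x ∈ U)) : DefP L (fun x => C x ∧ E x) := by
  have claim : ∀ S, Cov L n S → (∀ x ∈ S, E x) → DefP L (fun x => C x ∧ x ∈ S) := by
    intro S hS
    induction hS with
    | opn U h1 h2 h3 => exact hop U h1 h2 h3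
    | patch d hd Γ hΓ hfun =>
      intro _
      have h1 : DefP L (fun w => ∃ x, Γ w x ∧ C x) := by
        refine ih d hd (fun w => ∃ x, Γ w x ∧ Ω x)
          (fun w w' => ∃ x x', Γ w x ∧ Γ w' x' ∧ R x x') _ ?_ ?_ ?_
        · refine DefP.ex (DefP.and hΓ (hΩ.comp (by fun_prop)))
        · refine DefP.ex (DefP.ex (DefP.and ?_ (DefP.and ?_ ?_)))
          · exact DefP.comp2 hΓ (by fun_prop) (by fun_prop)
          · exact DefP.comp2 hΓ (by fun_prop) (by fun_prop)
          · exact DefP.comp2 hRR (by fun_prop) (by fun_prop)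
        · constructor
          · rintro w w' ⟨x, h1, h2⟩ ⟨x', h3, h4⟩
            rcases hcut.tot x x' h2 h4 with h | h
            · exact Or.inl ⟨x, x', h1, h3, h⟩
            · exact Or.inr ⟨x', x, h3, h1, h⟩
          · rintro w1 w2 w3 ⟨x1, a1, b1⟩ ⟨x2, a2, b2⟩ ⟨x3, a3, b3⟩ ⟨y1, y2, c1, c2, c3⟩
              ⟨z2, z3, d2, d3, d4⟩
            have e1 := hfun _ _ _ a1 c1
            have e2 := hfun _ _ _ a2 c2
            have e3 := hfun _ _ _ a2 d2
            have e4 := hfun _ _ _ a3 d3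
            subst e1; subst e2; subst e3; subst e4
            exact ⟨x1, x3, a1, a3, hcut.trans _ _ _ b1 b2 b3 c3 d4⟩
          · rintro w ⟨x, h1, h2⟩
            exact ⟨x, h1, hcut.sub x h2⟩
          · rintro w w' ⟨x, a1, b1⟩ ⟨x', a2, b2⟩ ⟨y, y', c1, c2, c3⟩
            have e1 := hfun _ _ _ a1 c1
            have e2 := hfun _ _ _ a2 c2
            subst e1; subst e2
            exact ⟨x, a1, hcut.down _ _ b1 b2 c3⟩
      have h2 : DefP L (fun x => ∃ w, Γ w x ∧ (fun w => ∃ x, Γ w x ∧ C x) w) := by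
        refine DefP.ex (DefP.and ?_ (h1.comp (by fun_prop)))
        exact DefP.comp2 hΓ (by fun_prop) (by fun_prop)
      refine h2.cgr fun x => ⟨?_, ?_⟩
      · rintro ⟨w, h3, x', h4, h5⟩
        rw [hfun _ _ _ h3 h4]
        exact ⟨h5, w, h4⟩
      · rintro ⟨h3, w, h4⟩
        exact ⟨w, h4, x, h4, h3⟩
    | union S T _ _ ihS ihT =>
      intro h
      refine ((ihS fun x hx => h x (Or.inl hx)).or (ihT fun x hx => h x (Or.inr hx))).cgr fun x => ?_
      rw [Set.mem_union]
      tauto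
  exact claim _ ((kk_uf hR n).1 E hE) (fun x hx => hx)

theorem Cuts.step (hR : IsOMinimal L ℝ) {n : ℕ} (ih : ∀ d, d < n → Cuts L d) : Cuts L n := by
  intro Ω R C hΩ hRR hcut
  by_cases h2 : ∀ c d, C c → Ω d → ¬ C d → ∃ e, ∀ᶠ e' in nhds e, Ω e' ∧ R c e' ∧ R e' d
  swap
  · push Not at h2
    obtain ⟨c, d, hc, hd, hdC, he⟩ := h2
    have hE : DefP L (fun u => Ω u ∧ R c u ∧ R u d) := by
      refine hΩ.and (DefP.and ?_ ?_)
      · exact DefP.comp2 hRR (by fun_prop) (by fun_prop)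
      · exact DefP.comp2 hRR (by fun_prop) (by fun_prop)
    have h1 := cut_cov hR ih hΩ hRR hcut hE (by
      intro U hU _ _ hUE
      have : U = ∅ := by
        by_contra hne
        obtain ⟨x, hx⟩ := Set.nonempty_iff_ne_empty.2 hne
        refine he x ?_
        filter_upwards [hU.mem_nhds hx] with y hy
        obtain ⟨a1, a2, a3⟩ := hUE y hy
        exact fun h => h a1 a2 a3
      subst this
      exact (DefP.cst False).cgr fun x => by simp)
    have h3 : DefP L (fun u => Ω u ∧ ¬ R c u) :=
      hΩ.and (DefP.not (DefP.comp2 hRR (by fun_prop) (by fun_prop)))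
    refine (h3.or h1).cgr fun u => ⟨?_, ?_⟩
    · rintro (⟨h4, h5⟩ | ⟨h4, -⟩)
      · exact hcut.down u c h4 hc ((hcut.tot c u (hcut.sub c hc) h4).resolve_left h5)
      · exact h4
    · intro hu
      by_cases h5 : R c u
      · refine Or.inr ⟨hu, hcut.sub u hu, h5, ?_⟩
        refine (hcut.tot u d (hcut.sub u hu) hd).resolve_right fun h6 => hdC ?_
        exact hcut.down d u hd hu h6
      · exact Or.inl ⟨hcut.sub u hu, h5⟩
  by_contra hC
  have hRop : DefP L (fun z : (Fin n → ℝ) × (Fin n → ℝ) => (fun u v => R v u) z.1 z.2) :=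
    DefP.comp2 hRR (by fun_prop) (by fun_prop)
  have hCop : ¬ DefP L (fun u => Ω u ∧ ¬ C u) := by
    intro h
    refine hC ((hΩ.and h.not).cgr fun u => ⟨fun h3 => ?_, fun h3 => ⟨hcut.sub u h3, fun h4 => h4.2 h3⟩⟩)
    by_contra h4
    exact h3.2 ⟨h3.1, h4⟩
  let G : (Fin n → ℝ) → Prop := fun x => (∀ᶠ x' in nhds x, Ω x') ∧ ¬ JJ Ω R x ∧
    ¬ JJ Ω (fun u v => R v u) x
  have hJ1 := JJ.defP hR hΩ hRR
  have hJ2 := JJ.defP (R := fun u v => R v u) hR hΩ hRop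
  have hG : DefP L G :=
    DefP.and (DefP.ev hR (hΩ.comp (by fun_prop)) (by fun_prop)) (hJ1.not.and hJ2.not)
  have c1 := cut_cov hR ih hΩ hRR hcut hG (by
    intro U hU hUc hUd hUG
    by_cases hsub : U ⊆ {x | C x}
    · exact hUd.cgr fun x => ⟨fun hx => ⟨hsub hx, hx⟩, fun hx => hx.2⟩
    by_cases hdis : ∃ x ∈ U, C x
    swap
    · push Not at hdis
      exact (DefP.cst False).cgr fun x => ⟨fun h => h.elim, fun h => hdis x h.2 h.1⟩
    exfalso
    obtain ⟨x, hxU, hxC⟩ := hdis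
    obtain ⟨y, hyU, hyC⟩ := Set.not_subset.1 hsub
    obtain ⟨z, hzU, hz⟩ := inter_frontier (C := {x | C x}) hUc hxU hxC hyU hyC
    rw [frontier_eq_closure_inter_closure] at hz
    have hGz := hUG z hzU
    by_cases hzC : C z
    · refine hGz.2.1 (JJ.key hR hΩ hRR hcut hC h2 hzC fun h => ?_)
      have h3 := mem_closure_iff_frequently.1 hz.2
      refine h3 ?_
      filter_upwards [h, hGz.1] with w h4 h5 h6
      exact h4 ⟨h5, h6⟩
    · refine hGz.2.2 (JJ.key (R := fun u v => R v u) hR hΩ hRop hcut.op hCop ?_ ⟨hGz.1.self_of_nhds, hzC⟩ fun h => ?_)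
      · rintro d c ⟨hd, hdC⟩ hc hcC
        have hcC : C c := by
          by_contra h
          exact hcC ⟨hc, h⟩
        obtain ⟨e, he⟩ := h2 c d hcC hd hdC
        refine ⟨e, ?_⟩
        filter_upwards [he] with e' h3
        exact ⟨h3.1, h3.2.2, h3.2.1⟩
      · have h3 := mem_closure_iff_frequently.1 hz.1
        refine h3 ?_
        filter_upwards [h] with w h4 h6
        exact h4 ⟨hcut.sub w h6, fun h7 => h7.2 h6⟩)
  have c2 := cut_cov hR ih hΩ hRR hcut (hΩ.and hG.not) (by
    intro U hU _ _ hUE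
    have : U = ∅ := by
      by_contra hne
      have hne := Set.nonempty_iff_ne_empty.2 hne
      obtain ⟨i, V, hV, hVn, -, hVS⟩ := bl hR (ι := Bool)
        (S := fun b x => match b with
          | true => JJ Ω R x
          | false => JJ Ω (fun u v => R v u) x) (by
          rintro (_ | _)
          · exact hJ2
          · exact hJ1) hU hne (by
          intro x hx
          have hev : ∀ᶠ x' in nhds x, Ω x' := by
            filter_upwards [hU.mem_nhds hx] with y hy using (hUE y hy).1
          by_cases hj : JJ Ω R x
          · exact ⟨true, hj⟩
          · refine ⟨false, ?_⟩
            by_contra hj2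
            exact (hUE x hx).2 ⟨hev, hj, hj2⟩)
      cases i with
      | true =>
        obtain ⟨x, hx, hx2⟩ := JJ.codense hR hΩ hRR hV hVn
        exact hx2 (hVS x hx)
      | false =>
        obtain ⟨x, hx, hx2⟩ := JJ.codense (R := fun u v => R v u) hR hΩ hRop hV hVn
        exact hx2 (hVS x hx)
    subst this
    exact (DefP.cst False).cgr fun x => by simp)
  refine hC ((c1.or c2).cgr fun u => ⟨?_, ?_⟩)
  · rintro (h | h) <;> exact h.1
  · intro h
    by_cases hg : G u
    · exact Or.inl ⟨h, hg⟩
    · exact Or.inr ⟨h, hcut.sub u h, hg⟩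

theorem cuts (hR : IsOMinimal L ℝ) : ∀ n, Cuts L n := by
  intro n
  induction n using Nat.strong_induction_on with
  | _ n ih => exact Cuts.step hR ih

end cuts

end OM

namespace OM

section dir
variable {L : FirstOrder.Language} [L.Structure ℝ]

theorem DSpace.exists_fin (L : FirstOrder.Language) [L.Structure ℝ] (X : Type) [DSpace X] :
    ∃ (m : ℕ) (e : X ≃ (Fin m → ℝ)), DM L e ∧ DM L e.symm := by
  obtain ⟨m, ⟨φ⟩⟩ := Finite.exists_equiv_fin (DSpace.ι X)
  have h1 : DM L (DSpace.e : X → (DSpace.ι X → ℝ)) := by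
    intro b
    have : (fun v : DSpace.ι X → ℝ => DSpace.e (DSpace.e (DSpace.e.symm v : X)) b) = fun v => v b := by
      funext v
      rw [Equiv.apply_symm_apply]
      rfl
    rw [this]
    exact Set.DefinableFun.proj L
  have h2 : DM L (DSpace.e.symm : (DSpace.ι X → ℝ) → X) := by
    intro b
    have : (fun v : DSpace.ι (DSpace.ι X → ℝ) → ℝ =>
        DSpace.e (DSpace.e.symm (DSpace.e.symm v : DSpace.ι X → ℝ) : X) b) = fun v => v b := by
      funext v
      rw [Equiv.apply_symm_apply]
      rfl
    rw [this]
    exact Set.DefinableFun.proj L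
  refine ⟨m, DSpace.e.trans (Equiv.arrowCongr φ (Equiv.refl ℝ)), ?_, ?_⟩
  · refine DM.pi fun a => ?_
    exact h1.app (φ.symm a)
  · exact h2.comp (f := fun v : Fin m → ℝ => fun i => v (φ i)) (by fun_prop)

theorem cutsX (hR : IsOMinimal L ℝ) {W : Type} [DSpace W] {Ω C : W → Prop} {R : W → W → Prop}
    (hΩ : DefP L Ω) (hRR : DefP L (fun z : W × W => R z.1 z.2)) (hcut : Cut Ω R C) : DefP L C := by
  obtain ⟨m, e, he, hes⟩ := DSpace.exists_fin L W
  have h := cuts hR m (fun w => Ω (e.symm w)) (fun w w' => R (e.symm w) (e.symm w'))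
    (fun w => C (e.symm w)) (hΩ.comp hes) (DefP.comp2 hRR (hes.comp (by fun_prop)) (hes.comp (by fun_prop)))
    ⟨fun u v => hcut.tot _ _, fun u v w => hcut.trans _ _ _, fun u => hcut.sub _,
      fun u v => hcut.down _ _⟩
  refine (h.comp he).cgr fun x => by simp

theorem ufX (hR : IsOMinimal L ℝ) {W : Type} [DSpace W] {D : W → ℝ → Prop}
    (hD : DefP L (fun z : W × ℝ => D z.1 z.2)) (hf : ∀ x, {y | D x y}.Finite) :
    ∃ N, ∀ x, {y | D x y}.ncard ≤ N := by
  obtain ⟨m, e, he, hes⟩ := DSpace.exists_fin L W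
  obtain ⟨N, hN⟩ := (kk_uf hR m).2 (fun w y => D (e.symm w) y)
    (DefP.comp2 hD (hes.comp (by fun_prop)) (by fun_prop)) (fun x => hf _)
  exact ⟨N, fun x => by simpa using hN (e x)⟩

/-- `p` restricted to `F` has a definable directed refinement inside `p`. -/
def Dir (L : FirstOrder.Language) [L.Structure ℝ] {n : ℕ} (p : Ultrafilter (Fin n → ℝ))
    (F : Set (Set (Fin n → ℝ))) : Prop :=
  ∃ (W : Type) (_ : DSpace W) (Ω : W → Prop) (E : W → (Fin n → ℝ) → Prop),
    DefP L Ω ∧ DefP L (fun z : W × (Fin n → ℝ) => E z.1 z.2) ∧ (∃ w, Ω w) ∧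
    (∀ w, Ω w → {x | E w x} ∈ p) ∧
    (∀ w w', Ω w → Ω w' → ∃ w'', Ω w'' ∧ ∀ x, E w'' x → E w x ∧ E w' x) ∧
    ∀ Y ∈ F, Y ∈ p → ∃ w, Ω w ∧ ∀ x, E w x → x ∈ Y

theorem Dir.join {n : ℕ} {p : Ultrafilter (Fin n → ℝ)} {F G H : Set (Set (Fin n → ℝ))}
    (hF : Dir L p F) (hG : Dir L p G)
    (h : ∀ Y ∈ H, Y ∈ p → ∃ Y1 ∈ p, ∃ Y2 ∈ p, (Y1 ∈ F ∨ Y1 = Set.univ) ∧ (Y2 ∈ G ∨ Y2 = Set.univ) ∧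
      Y1 ∩ Y2 ⊆ Y) : Dir L p H := by
  obtain ⟨W, _, Ω, E, h1, h2, h3, h4, h5, h6⟩ := hF
  obtain ⟨W', _, Ω', E', h1', h2', h3', h4', h5', h6'⟩ := hG
  refine ⟨W × W', inferInstance, fun w => Ω w.1 ∧ Ω' w.2, fun w x => E w.1 x ∧ E' w.2 x,
    ?_, ?_, ?_, ?_, ?_, ?_⟩
  · exact (h1.comp (by fun_prop)).and (h1'.comp (by fun_prop))
  · exact (DefP.comp2 h2 (by fun_prop) (by fun_prop)).and (DefP.comp2 h2' (by fun_prop) (by fun_prop))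
  · obtain ⟨w, hw⟩ := h3
    obtain ⟨w', hw'⟩ := h3'
    exact ⟨(w, w'), hw, hw'⟩
  · rintro w ⟨hw, hw'⟩
    exact Filter.inter_mem (h4 _ hw) (h4' _ hw')
  · rintro ⟨a, a'⟩ ⟨b, b'⟩ ⟨ha, ha'⟩ ⟨hb, hb'⟩
    obtain ⟨c, hc, e⟩ := h5 _ _ ha hb
    obtain ⟨c', hc', e'⟩ := h5' _ _ ha' hb'
    exact ⟨(c, c'), ⟨hc, hc'⟩, fun x hx => ⟨⟨(e x hx.1).1, (e' x hx.2).1⟩, (e x hx.1).2, (e' x hx.2).2⟩⟩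
  · intro Y hY hYp
    obtain ⟨Y1, hp1, Y2, hp2, hY1, hY2, hsub⟩ := h Y hY hYp
    have a1 : ∃ w, Ω w ∧ ∀ x, E w x → x ∈ Y1 := by
      rcases hY1 with hY1 | rfl
      · exact h6 _ hY1 hp1
      · obtain ⟨w, hw⟩ := h3
        exact ⟨w, hw, fun _ _ => trivial⟩
    have a2 : ∃ w, Ω' w ∧ ∀ x, E' w x → x ∈ Y2 := by
      rcases hY2 with hY2 | rfl
      · exact h6' _ hY2 hp2
      · obtain ⟨w, hw⟩ := h3'
        exact ⟨w, hw, fun _ _ => trivial⟩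
    obtain ⟨w, hw, e⟩ := a1
    obtain ⟨w', hw', e'⟩ := a2
    exact ⟨(w, w'), ⟨hw, hw'⟩, fun x hx => hsub ⟨e x hx.1, e' x hx.2⟩⟩

theorem Dir.trivial {n : ℕ} {p : Ultrafilter (Fin n → ℝ)} {F : Set (Set (Fin n → ℝ))}
    (h : ∀ Y ∈ F, Y ∈ p → Y = Set.univ) : Dir L p F :=
  ⟨ℝ, inferInstance, fun _ => True, fun _ _ => True, DefP.cst True, DefP.cst True, ⟨0, _root_.trivial⟩,
    fun _ _ => Filter.mem_of_superset Filter.univ_mem (fun _ _ => _root_.trivial), fun w _ _ _ => ⟨w, _root_.trivial, fun _ _ => ⟨_root_.trivial, _root_.trivial⟩⟩,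
    fun Y hY hp => ⟨0, _root_.trivial, fun x _ => by rw [h Y hY hp]; exact Set.mem_univ x⟩⟩

theorem Dir.inter {n : ℕ} {p : Ultrafilter (Fin n → ℝ)} {W : Type} {f g : W → Set (Fin n → ℝ)}
    (hF : Dir L p (Set.range f)) (hG : Dir L p (Set.range g)) :
    Dir L p (Set.range fun u => f u ∩ g u) := by
  refine hF.join hG ?_
  rintro _ ⟨u, rfl⟩ hp
  exact ⟨f u, Filter.mem_of_superset hp Set.inter_subset_left, g u,
    Filter.mem_of_superset hp Set.inter_subset_right, Or.inl ⟨u, rfl⟩, Or.inl ⟨u, rfl⟩, le_rfl⟩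

theorem Dir.union {n : ℕ} {p : Ultrafilter (Fin n → ℝ)} {F G : Set (Set (Fin n → ℝ))}
    (hF : Dir L p F) (hG : Dir L p G) : Dir L p (F ∪ G) := by
  refine hF.join hG ?_
  rintro Y (hY | hY) hp
  · exact ⟨Y, hp, Set.univ, Filter.univ_mem, Or.inl hY, Or.inr rfl, Set.inter_subset_left⟩
  · exact ⟨Set.univ, Filter.univ_mem, Y, hp, Or.inr rfl, Or.inl hY, Set.inter_subset_right⟩

theorem Dir.mono {n : ℕ} {p : Ultrafilter (Fin n → ℝ)} {F G : Set (Set (Fin n → ℝ))}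
    (hF : Dir L p F) (h : ∀ Y ∈ G, Y ∈ p → ∃ Z ∈ F, Z ∈ p ∧ Z ⊆ Y) : Dir L p G := by
  refine hF.join hF ?_
  intro Y hY hp
  obtain ⟨Z, h1, h2, h3⟩ := h Y hY hp
  exact ⟨Z, h2, Z, h2, Or.inl h1, Or.inl h1, Set.inter_subset_left.trans h3⟩

theorem Dir.iUnion {n : ℕ} {p : Ultrafilter (Fin n → ℝ)} {F : ℕ → Set (Set (Fin n → ℝ))}
    (hF : ∀ i, Dir L p (F i)) : ∀ N : ℕ, Dir L p {Y | ∃ i, i < N ∧ Y ∈ F i}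
  | 0 => Dir.trivial (by simp)
  | N + 1 => by
    refine ((Dir.iUnion hF N).union (hF N)).mono ?_
    rintro Y ⟨i, hi, hY⟩ hp
    refine ⟨Y, ?_, hp, le_rfl⟩
    rcases Nat.lt_succ_iff_lt_or_eq.1 hi with h | rfl
    · exact Or.inl ⟨i, h, hY⟩
    · exact Or.inr hY

/-- Directed refinements exist in dimension `n`. -/
def DIR (L : FirstOrder.Language) [L.Structure ℝ] (n : ℕ) : Prop :=
  ∀ (p : Ultrafilter (Fin n → ℝ)) (W : Type) (_ : DSpace W) (D : W → (Fin n → ℝ) → Prop),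
    DefP L (fun z : W × (Fin n → ℝ) => D z.1 z.2) → Dir L p (Set.range fun u => {x | D u x})

theorem DIR.zero : DIR L 0 := by
  intro p W _ D hD
  refine Dir.trivial ?_
  rintro Y - hp
  obtain ⟨y, hy⟩ := p.nonempty_of_mem hp
  ext x
  simp only [Set.mem_univ, iff_true]
  rwa [Subsingleton.elim x y]

theorem DIR.ms {n : ℕ} (h : DIR L n) (p : Ultrafilter (Fin n → ℝ)) {W : Type} [DSpace W]
    {D : W → (Fin n → ℝ) → Prop} (hD : DefP L (fun z : W × (Fin n → ℝ) => D z.1 z.2)) :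
    DefP L (fun u => {x | D u x} ∈ p) := by
  obtain ⟨V, _, Ω, E, h1, h2, h3, h4, h5, h6⟩ := h p W _ D hD
  have : DefP L (fun u => ∃ w, Ω w ∧ ∀ x, E w x → D u x) := by
    refine DefP.ex (DefP.and (h1.comp (by fun_prop)) (DefP.all (DefP.imp ?_ ?_)))
    · exact DefP.comp2 h2 (by fun_prop) (by fun_prop)
    · exact DefP.comp2 hD (by fun_prop) (by fun_prop)
  refine this.cgr fun u => ⟨?_, fun hu => h6 _ ⟨u, rfl⟩ hu⟩
  rintro ⟨w, hw, hs⟩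
  exact Filter.mem_of_superset (h4 w hw) hs

theorem Dir.chain (hR : IsOMinimal L ℝ) {n : ℕ} (h : DIR L n) (p : Ultrafilter (Fin (n+1) → ℝ))
    {W : Type} [DSpace W] {D : W → (Fin (n+1) → ℝ) → Prop}
    (hD : DefP L (fun z : W × (Fin (n+1) → ℝ) => D z.1 z.2))
    (hch : ∀ (x : Fin n → ℝ) u u', (∀ y : ℝ, D u (Fin.snoc x y) → D u' (Fin.snoc x y)) ∨
      (∀ y : ℝ, D u' (Fin.snoc x y) → D u (Fin.snoc x y))) :
    Dir L p (Set.range fun u => {x | D u x}) := by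
  let q : Ultrafilter (Fin n → ℝ) := p.map (fun z => (Fin.init z : Fin n → ℝ))
  have hq : ∀ S : Set (Fin n → ℝ), S ∈ q ↔ {z : Fin (n+1) → ℝ | (Fin.init z : Fin n → ℝ) ∈ S} ∈ p :=
    fun S => Iff.rfl
  let A : W × W → (Fin n → ℝ) → Prop := fun u x => ∀ y : ℝ, D u.2 (Fin.snoc x y) → D u.1 (Fin.snoc x y)
  have hA : DefP L (fun z : (W × W) × (Fin n → ℝ) => A z.1 z.2) := by
    refine DefP.all (DefP.imp ?_ ?_)
    · exact DefP.comp2 hD (by fun_prop) (by fun_prop)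
    · exact DefP.comp2 hD (by fun_prop) (by fun_prop)
  have hRR := h.ms q hA
  let R : W → W → Prop := fun u u' => {x | A (u, u') x} ∈ q
  have hcut : Cut (fun _ : W => True) R (fun u => {z | D u z} ∈ p) := by
    constructor
    · intro u v _ _
      refine Ultrafilter.union_mem_iff.1 (Filter.mem_of_superset Filter.univ_mem ?_)
      intro x _
      rcases hch x u v with h | h
      · exact Or.inr h
      · exact Or.inl h
    · intro u v w _ _ _ h1 h2
      refine Filter.mem_of_superset (Filter.inter_mem h1 h2) ?_
      rintro x ⟨a, b⟩ y hy
      exact a y (b y hy)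
    · intro u _
      trivial
    · intro u v _ h1 h2
      refine Filter.mem_of_superset (Filter.inter_mem h1 ((hq _).1 h2)) ?_
      rintro z ⟨a, b⟩
      have := b (z (Fin.last n))
      simp only [Fin.snoc_init_self] at this
      exact this a
  have hC := cutsX hR (DefP.cst True) hRR hcut
  by_cases hex : ∃ u, {z | D u z} ∈ p
  swap
  · refine Dir.trivial ?_
    rintro _ ⟨u, rfl⟩ hp
    exact absurd ⟨u, hp⟩ hex
  obtain ⟨u0, hu0⟩ := hex
  obtain ⟨V, _, Ω, E, h1, h2, ⟨w0, hw0⟩, h4, h5, h6⟩ := h q (W × W) _ A hA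
  refine ⟨W × V, inferInstance, fun w => {z | D w.1 z} ∈ p ∧ Ω w.2, fun w z => D w.1 z ∧ E w.2 (Fin.init z),
    ?_, ?_, ⟨(u0, w0), hu0, hw0⟩, ?_, ?_, ?_⟩
  · exact (hC.comp (f := fun w : W × V => w.1) (by fun_prop)).and (h1.comp (by fun_prop))
  · exact (DefP.comp2 hD (by fun_prop) (by fun_prop)).and (DefP.comp2 h2 (by fun_prop) (by fun_prop))
  · rintro ⟨u, w⟩ ⟨a, b⟩
    exact Filter.inter_mem a ((hq _).1 (h4 w b))
  · have aux : ∀ u u' w w', {z | D u' z} ∈ p → Ω w → Ω w' → R u u' → ∃ w'', Ω w'' ∧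
        ∀ z : Fin (n+1) → ℝ, (D u' z ∧ E w'' (Fin.init z)) →
          D u z ∧ E w (Fin.init z) ∧ E w' (Fin.init z) := by
      intro u u' w w' a b b' hr
      obtain ⟨w1, c1, d1⟩ := h6 _ ⟨(u, u'), rfl⟩ hr
      obtain ⟨w2, c2, d2⟩ := h5 _ _ b b'
      obtain ⟨w3, c3, d3⟩ := h5 _ _ c1 c2
      refine ⟨w3, c3, fun z hz => ?_⟩
      have e1 := d3 _ hz.2
      have e2 := d2 _ e1.2
      have e3 := d1 _ e1.1 (z (Fin.last n))
      simp only [Fin.snoc_init_self] at e3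
      exact ⟨e3 hz.1, e2⟩
    rintro ⟨u, w⟩ ⟨u', w'⟩ ⟨a, b⟩ ⟨a', b'⟩
    rcases hcut.tot u u' _root_.trivial _root_.trivial with hr | hr
    · obtain ⟨w3, c3, d3⟩ := aux u u' w w' a' b b' hr
      refine ⟨(u', w3), ⟨a', c3⟩, fun z hz => ?_⟩
      have := d3 z hz
      exact ⟨⟨this.1, this.2.1⟩, hz.1, this.2.2⟩
    · obtain ⟨w3, c3, d3⟩ := aux u' u w' w a b' b hr
      refine ⟨(u, w3), ⟨a, c3⟩, fun z hz => ?_⟩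
      have := d3 z hz
      exact ⟨⟨hz.1, this.2.2⟩, this.1, this.2.1⟩
  · rintro _ ⟨u, rfl⟩ hp
    exact ⟨(u, w0), ⟨hp, hw0⟩, fun z hz => hz.1⟩

/-- At least `i+1` points of `T` up to `y` included. -/
def CL (T : ℝ → Prop) (i : ℕ) (y : ℝ) : Prop := ∃ y', y' ≤ y ∧ T y' ∧ CG T i y'

theorem DIR.step (hR : IsOMinimal L ℝ) {n : ℕ} (h : DIR L n) : DIR L (n+1) := by
  intro p W _ D hD
  let T : W × (Fin n → ℝ) → ℝ → Prop := fun w y => D w.1 (Fin.snoc w.2 y)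
  have hT : DefP L (fun z : (W × (Fin n → ℝ)) × ℝ => T z.1 z.2) :=
    DefP.comp2 hD (by fun_prop) (by fun_prop)
  have hTx : ∀ w, DefP L (T w) := fun w => DefP.comp2 hT (by fun_prop) (by fun_prop)
  let F : W × (Fin n → ℝ) → ℝ → Prop := fun w => FrP (T w)
  have hF : DefP L (fun z : (W × (Fin n → ℝ)) × ℝ => F z.1 z.2) := frP_defP hR hT
  have hFf : ∀ w, {y | F w y}.Finite := fun w => frP_finite hR (hTx w)
  obtain ⟨N, hN⟩ := ufX hR hF hFf
  have hCG : ∀ i, DefP L (fun z : (W × (Fin n → ℝ)) × ℝ => (fun w y => CG (F w) i y) z.1 z.2) :=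
    fun i => CG.defP hR hF i
  have hCL : ∀ i, DefP L (fun z : (W × (Fin n → ℝ)) × ℝ => (fun w y => CL (F w) i y) z.1 z.2) := by
    intro i
    refine DefP.ex (DefP.and ?_ (DefP.and ?_ ?_))
    · exact DefP.le hR (by fun_prop) (by fun_prop)
    · exact DefP.comp2 hF (by fun_prop) (by fun_prop)
    · exact DefP.comp2 (P := fun w y => CG (F w) i y) (hCG i) (by fun_prop) (by fun_prop)
  -- upward closed families
  have hup : ∀ Q : W × (Fin n → ℝ) → ℝ → Prop,
      DefP L (fun z : (W × (Fin n → ℝ)) × ℝ => Q z.1 z.2) → (∀ w y y', y ≤ y' → Q w y → Q w y') →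
      Dir L p (Set.range fun u => {z : Fin (n+1) → ℝ | Q (u, Fin.init z) (z (Fin.last n))}) ∧
      Dir L p (Set.range fun u => {z : Fin (n+1) → ℝ | ¬ Q (u, Fin.init z) (z (Fin.last n))}) := by
    intro Q hQ hmono
    have hQ' : DefP L (fun z : W × (Fin (n+1) → ℝ) => Q (z.1, Fin.init z.2) (z.2 (Fin.last n))) :=
      DefP.comp2 hQ (by fun_prop) (by fun_prop)
    have hcmp : ∀ w w', (∀ y, Q w y → Q w' y) ∨ (∀ y, Q w' y → Q w y) := by
      intro w w'
      by_contra hc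
      push Not at hc
      obtain ⟨⟨y, h1, h2⟩, ⟨y', h3, h4⟩⟩ := hc
      rcases le_total y y' with hy | hy
      · exact h4 (hmono _ _ _ hy h1)
      · exact h2 (hmono _ _ _ hy h3)
    constructor
    · refine Dir.chain hR h p (D := fun u z => Q (u, Fin.init z) (z (Fin.last n))) hQ' ?_
      intro x u u'
      simp only [Fin.init_snoc, Fin.snoc_last]
      exact hcmp _ _
    · refine Dir.chain hR h p (D := fun u z => ¬ Q (u, Fin.init z) (z (Fin.last n))) hQ'.not ?_
      intro x u u'
      simp only [Fin.init_snoc, Fin.snoc_last, not_imp_not]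
      exact (hcmp _ _).symm
  let B : ℕ → Prop → W × (Fin n → ℝ) → ℝ → Prop := fun i b w y =>
    (CG (F w) i y ∧ ¬ CG (F w) (i+1) y) ∧ (F w y ↔ b)
  have hB : ∀ i b, DefP L (fun z : (W × (Fin n → ℝ)) × ℝ => B i b z.1 z.2) := fun i b =>
    ((hCG i).and (hCG (i+1)).not).and (hF.iff (DefP.cst b))
  have hBdir : ∀ i b, Dir L p (Set.range fun u => {z : Fin (n+1) → ℝ |
      B i b (u, Fin.init z) (z (Fin.last n))}) := by
    intro i b
    have h1 := (hup (fun w y => CG (F w) i y) (hCG i) fun w y y' hy => CG.mono hy).1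
    have h2 := (hup (fun w y => CG (F w) (i+1) y) (hCG (i+1)) fun w y y' hy => CG.mono hy).2
    have h3 := hup (fun w y => CL (F w) i y) (hCL i) fun w y y' hy h => by
      obtain ⟨z, a1, a2⟩ := h
      exact ⟨z, a1.trans hy, a2⟩
    have key : ∀ w y, CG (F w) i y → ¬ CG (F w) (i+1) y → (F w y ↔ CL (F w) i y) := by
      intro w y a1 a2
      constructor
      · intro a3
        exact ⟨y, le_rfl, a3, a1⟩
      · rintro ⟨y', a3, a4, a5⟩
        rcases eq_or_lt_of_le a3 with rfl | a3
        · exact a4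
        · exact absurd ⟨y', a3, a4, a5⟩ a2
    have h12 := h1.inter h2
    by_cases hb : b
    · refine (h12.inter h3.1).mono ?_
      rintro _ ⟨u, rfl⟩ hp
      refine ⟨_, ⟨u, rfl⟩, Filter.mem_of_superset hp ?_, ?_⟩
      · rintro z ⟨⟨a1, a2⟩, a3⟩
        exact ⟨⟨a1, a2⟩, (key _ _ a1 a2).1 (a3.2 hb)⟩
      · rintro z ⟨⟨a1, a2⟩, a3⟩
        exact ⟨⟨a1, a2⟩, ⟨fun _ => hb, fun _ => (key _ _ a1 a2).2 a3⟩⟩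
    · refine (h12.inter h3.2).mono ?_
      rintro _ ⟨u, rfl⟩ hp
      refine ⟨_, ⟨u, rfl⟩, Filter.mem_of_superset hp ?_, ?_⟩
      · rintro z ⟨⟨a1, a2⟩, a3⟩
        exact ⟨⟨a1, a2⟩, fun h => hb (a3.1 ((key _ _ a1 a2).2 h))⟩
      · rintro z ⟨⟨a1, a2⟩, a3⟩
        exact ⟨⟨a1, a2⟩, ⟨fun h => absurd ((key _ _ a1 a2).1 h) a3, fun h => absurd h hb⟩⟩
  have hcyl : ∀ i b, Dir L p (Set.range fun u => {z : Fin (n+1) → ℝ |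
      ∀ y, B i b (u, Fin.init z) y → T (u, Fin.init z) y}) := by
    intro i b
    refine Dir.chain hR h p (D := fun u z => ∀ y, B i b (u, Fin.init z) y → T (u, Fin.init z) y) ?_ ?_
    · refine DefP.all (DefP.imp ?_ ?_)
      · exact DefP.comp2 (hB i b) (by fun_prop) (by fun_prop)
      · exact DefP.comp2 hT (by fun_prop) (by fun_prop)
    · intro x u u'
      simp only [Fin.init_snoc]
      by_cases h1 : ∀ y, B i b (u, x) y → T (u, x) y
      · exact Or.inr fun _ _ => h1
      · exact Or.inl fun _ h2 => absurd h2 h1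
  have hall := (Dir.iUnion (fun i => (hBdir i True).inter (hcyl i True)) (N+1)).union
    (Dir.iUnion (fun i => (hBdir i False).inter (hcyl i False)) (N+1))
  refine hall.mono ?_
  rintro _ ⟨u, rfl⟩ hp
  have hz : ∀ z : Fin (n+1) → ℝ, T (u, Fin.init z) (z (Fin.last n)) ↔ D u z := by
    intro z
    simp only [T, Fin.snoc_init_self]
  -- constancy on pieces
  have hconst : ∀ i b w y y', B i b w y → B i b w y' → T w y → T w y' := by
    have hlt : ∀ i b w y y', y < y' → B i b w y → B i b w y' → (T w y ↔ T w y') := by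
      intro i b w y y' hy h1 h2
      have hnF : ¬ F w y := fun hc => h2.1.2 ⟨y, hy, hc, h1.1.1⟩
      have hb : ¬ b := fun hb => hnF (h1.2.2 hb)
      refine frP_const hy.le fun v e1 e2 hv => ?_
      rcases eq_or_lt_of_le e2 with rfl | e2
      · exact hb (h2.2.1 hv)
      · exact h2.1.2 ⟨v, e2, hv, h1.1.1.mono e1⟩
    intro i b w y y' h1 h2 h3
    rcases lt_trichotomy y y' with hy | rfl | hy
    · exact (hlt i b w y y' hy h1 h2).1 h3
    · exact h3
    · exact (hlt i b w y' y hy h2 h1).2 h3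
  have hcov : ∃ i, i ∈ Set.Iio (N+1) ∧ {z | D u z} ∩ ({z : Fin (n+1) → ℝ |
      B i True (u, Fin.init z) (z (Fin.last n))} ∪ {z : Fin (n+1) → ℝ |
      B i False (u, Fin.init z) (z (Fin.last n))}) ∈ p := by
    refine (Ultrafilter.finite_biUnion_mem_iff (Set.finite_Iio (N+1))).1 (Filter.mem_of_superset hp ?_)
    intro z hzD
    obtain ⟨i, h1, h2, h3⟩ := CG.exact (hFf (u, Fin.init z)) (hN _) (z (Fin.last n))
    refine Set.mem_biUnion (x := i) h1 ⟨hzD, ?_⟩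
    by_cases hFz : F (u, Fin.init z) (z (Fin.last n))
    · exact Or.inl ⟨⟨h2, h3⟩, ⟨fun _ => _root_.trivial, fun _ => hFz⟩⟩
    · exact Or.inr ⟨⟨h2, h3⟩, ⟨hFz, fun h => h.elim⟩⟩
  obtain ⟨i, hi, hip⟩ := hcov
  rw [Set.inter_union_distrib_left, Ultrafilter.union_mem_iff] at hip
  have fin : ∀ b, {z | D u z} ∩ {z : Fin (n+1) → ℝ | B i b (u, Fin.init z) (z (Fin.last n))} ∈ p →
      ({z : Fin (n+1) → ℝ | B i b (u, Fin.init z) (z (Fin.last n))} ∩ {z : Fin (n+1) → ℝ |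
      ∀ y, B i b (u, Fin.init z) y → T (u, Fin.init z) y}) ∈ p ∧
      ({z : Fin (n+1) → ℝ | B i b (u, Fin.init z) (z (Fin.last n))} ∩ {z : Fin (n+1) → ℝ |
      ∀ y, B i b (u, Fin.init z) y → T (u, Fin.init z) y}) ⊆ {z | D u z} := by
    intro b hb
    constructor
    · refine Filter.mem_of_superset hb ?_
      rintro z ⟨h1, h2⟩
      exact ⟨h2, fun y hy => hconst i b _ _ _ h2 hy ((hz z).2 h1)⟩
    · rintro z ⟨h1, h2⟩
      exact (hz z).1 (h2 _ h1)
  rcases hip with hip | hip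
  · exact ⟨_, Or.inl ⟨i, hi, u, rfl⟩, fin _ hip⟩
  · exact ⟨_, Or.inr ⟨i, hi, u, rfl⟩, fin _ hip⟩

theorem dir (hR : IsOMinimal L ℝ) : ∀ n, DIR L n := by
  intro n
  induction n with
  | zero => exact DIR.zero
  | succ n ih => exact ih.step hR

end dir

end OM

namespace OM

section fin
variable {L : FirstOrder.Language} [L.Structure ℝ]

theorem compact_of_defCompact (hR : IsOMinimal L ℝ)
    (k : ℕ) (X : Set (Fin k → ℝ)) [TopologicalSpace ↥X] (hX : IsDefTopSpace L X)
    (hc : DefinablyCompact L X) : CompactSpace ↥X := by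
  obtain ⟨hXd, B, ⟨m, Ω₀, D, hΩ₀, hD, rfl⟩, hBX, hbas⟩ := hX
  have hXd' : DefP L (fun x => x ∈ X) := (defP_iff X).2 hXd
  have hΩ₀' : DefP L (fun x => x ∈ Ω₀) := (defP_iff Ω₀).2 hΩ₀
  have hD' : DefP L (fun x => x ∈ D) := (defP_iff D).2 hD
  have hD2 : DefP L (fun z : (Fin m → ℝ) × (Fin k → ℝ) => Sum.elim z.1 z.2 ∈ D) :=
    hD'.comp (DM.elim DM.fst DM.snd)
  refine ⟨isCompact_iff_ultrafilter_le_nhds.2 fun P _ => ?_⟩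
  let p : Ultrafilter (Fin k → ℝ) := P.map Subtype.val
  have hpX : X ∈ p := by
    change Subtype.val ⁻¹' X ∈ P
    rw [Subtype.coe_preimage_self]
    exact Filter.univ_mem
  obtain ⟨W, iW, Ω, E, hΩ, hE, hne, hEp, hdir, hbase⟩ :=
    dir hR k p (Fin m → ℝ) inferInstance (fun u x => Sum.elim u x ∉ D) hD2.not
  -- the closures
  let cl : W → (Fin k → ℝ) → Prop := fun w x => x ∈ X ∧ ∀ u, u ∈ Ω₀ → Sum.elim u x ∈ D →
    ∃ z, z ∈ X ∧ E w z ∧ Sum.elim u z ∈ D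
  have hcl : DefP L (fun z : W × (Fin k → ℝ) => cl z.1 z.2) := by
    refine (hXd'.comp DM.snd).and (DefP.all ?_)
    refine (hΩ₀'.comp DM.snd).imp (DefP.imp ?_ (DefP.ex ?_))
    · exact hD'.comp (DM.elim DM.snd DM.fst.snd')
    · refine (hXd'.comp DM.snd).and (DefP.and ?_ ?_)
      · exact hE.comp2 DM.fst.fst'.fst' DM.snd
      · exact hD'.comp (DM.elim DM.fst.snd' DM.snd)
  obtain ⟨N, e, he, he'⟩ := DSpace.exists_fin L W
  have hinl : DM L (fun v : Fin N ⊕ Fin k → ℝ => fun i : Fin N => v (Sum.inl i)) :=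
    DM.pi fun a => DM.eval _
  have hinr : DM L (fun v : Fin N ⊕ Fin k → ℝ => fun i : Fin k => v (Sum.inr i)) :=
    DM.pi fun a => DM.eval _
  have hfib : ∀ w, famFiber {v : Fin N ⊕ Fin k → ℝ |
      cl (e.symm fun i => v (Sum.inl i)) fun i => v (Sum.inr i)} (e w) = {x | cl w x} := by
    intro w
    ext x
    change cl (e.symm (e w)) x ↔ cl w x
    rw [e.symm_apply_apply]
  have hfam : IsDefFamily L (Set.univ : Set ℝ) k {Y | ∃ w, Ω w ∧ Y = {x | cl w x}} := by
    refine ⟨N, {v | Ω (e.symm v)}, {v | cl (e.symm fun i => v (Sum.inl i)) fun i => v (Sum.inr i)},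
      (defP_iff _).1 (hΩ.comp he'), (defP_iff _).1 (hcl.comp2 (he'.comp hinl) hinr), ?_⟩
    ext Y
    constructor
    · rintro ⟨w, hw, rfl⟩
      refine ⟨e w, ?_, hfib w⟩
      change Ω (e.symm (e w))
      rwa [e.symm_apply_apply]
    · rintro ⟨v, hv, rfl⟩
      refine ⟨e.symm v, hv, ?_⟩
      rw [← hfib, e.apply_symm_apply]
  have hnonempty : ∀ w, Ω w → {x | cl w x}.Nonempty := by
    intro w hw
    obtain ⟨x, hx1, hx2⟩ := p.nonempty_of_mem (Filter.inter_mem hpX (hEp w hw))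
    exact ⟨x, hx1, fun u hu hux => ⟨x, hx1, hx2, hux⟩⟩
  have hlim : (⋂₀ {Y | ∃ w, Ω w ∧ Y = {x | cl w x}}).Nonempty := by
    refine hc _ hfam ⟨?_, ?_⟩ ?_
    · rintro ⟨w, hw, h⟩
      exact (hnonempty w hw).ne_empty h.symm
    · rintro _ ⟨w, hw, rfl⟩ _ ⟨w', hw', rfl⟩
      obtain ⟨w'', hw'', h⟩ := hdir w w' hw hw'
      refine ⟨_, ⟨w'', hw'', rfl⟩, ?_⟩
      rintro x ⟨hx, hx2⟩
      constructor
      · refine ⟨hx, fun u hu hux => ?_⟩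
        obtain ⟨z, a1, a2, a3⟩ := hx2 u hu hux
        exact ⟨z, a1, (h z a2).1, a3⟩
      · refine ⟨hx, fun u hu hux => ?_⟩
        obtain ⟨z, a1, a2, a3⟩ := hx2 u hu hux
        exact ⟨z, a1, (h z a2).2, a3⟩
    · rintro _ ⟨w, hw, rfl⟩
      refine ⟨hnonempty w hw, fun x hx => hx.1, ?_⟩
      have : (Subtype.val ⁻¹' {x | cl w x} : Set ↥X) = closure {x : ↥X | E w x} := by
        ext x
        rw [hbas.mem_closure_iff]
        constructor
        · rintro ⟨-, h⟩ _ ⟨_, ⟨u, hu, rfl⟩, rfl⟩ hxu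
          obtain ⟨z, a1, a2, a3⟩ := h u hu hxu
          exact ⟨⟨z, a1⟩, a3, a2⟩
        · intro h
          refine ⟨x.2, fun u hu hux => ?_⟩
          obtain ⟨z, a1, a2⟩ := h _ ⟨_, ⟨u, hu, rfl⟩, rfl⟩ hux
          exact ⟨z, z.2, a2, a1⟩
      rw [this]
      exact isClosed_closure
  obtain ⟨x, hx⟩ := hlim
  have hx' : ∀ w, Ω w → cl w x := fun w hw => hx _ ⟨w, hw, rfl⟩
  obtain ⟨w₀, hw₀⟩ := hne
  refine ⟨⟨x, (hx' w₀ hw₀).1⟩, Set.mem_univ _, ?_⟩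
  intro V hV
  obtain ⟨_, ⟨_, ⟨u, hu, rfl⟩, rfl⟩, hxU, hUV⟩ := hbas.mem_nhds_iff.1 hV
  refine Filter.mem_of_superset ?_ hUV
  by_contra hcon
  have hco : {z | Sum.elim u z ∉ D} ∈ p := by
    change Subtype.val ⁻¹' {z | Sum.elim u z ∉ D} ∈ P
    exact Ultrafilter.compl_mem_iff_notMem.2 hcon
  obtain ⟨w, hw, hsub⟩ := hbase _ ⟨u, rfl⟩ hco
  obtain ⟨z, -, a2, a3⟩ := (hx' w hw).2 u hu hxU
  exact hsub z a2 a3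

theorem defCompact_of_compact (k : ℕ) (X : Set (Fin k → ℝ)) [TopologicalSpace ↥X]
    [CompactSpace ↥X] : DefinablyCompact L X := by
  intro C _ hdir hC
  rcases C.eq_empty_or_nonempty with rfl | hne
  · rw [Set.sInter_empty]
    exact Set.univ_nonempty
  have : Nonempty C := hne.to_subtype
  have h := IsCompact.nonempty_iInter_of_directed_nonempty_isCompact_isClosed
    (fun Y : C => (Subtype.val ⁻¹' (Y : Set (Fin k → ℝ)) : Set ↥X)) ?_ ?_ ?_ ?_
  · obtain ⟨x, hx⟩ := h
    exact ⟨x, fun Y hY => Set.mem_iInter.1 hx ⟨Y, hY⟩⟩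
  · rintro ⟨Y, hY⟩ ⟨Z, hZ⟩
    obtain ⟨T, hT, hTs⟩ := hdir.2 Y hY Z hZ
    exact ⟨⟨T, hT⟩, fun x hx => (hTs hx).1, fun x hx => (hTs hx).2⟩
  · rintro ⟨Y, hY⟩
    obtain ⟨⟨y, hy⟩, hs, -⟩ := hC Y hY
    exact ⟨⟨y, hs hy⟩, hy⟩
  · rintro ⟨Y, hY⟩
    exact (hC Y hY).2.2.isCompact
  · rintro ⟨Y, hY⟩
    exact (hC Y hY).2.2

end fin

end OM

/-- in an o-minimal expansion of `(ℝ,<)`, a definable topological space is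
definably compact if and only if it is compact. -/
theorem statement18 (L : FirstOrder.Language) [L.Structure ℝ] (hR : IsOMinimal L ℝ)
    (k : ℕ) (X : Set (Fin k → ℝ)) [TopologicalSpace ↥X] (hX : IsDefTopSpace L X) :
    DefinablyCompact L X ↔ CompactSpace ↥X := by
  exact ⟨fun h => OM.compact_of_defCompact hR k X hX h, fun _ => OM.defCompact_of_compact k X⟩
end
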